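/- arXiv:1201.6294 — 10 statements merged into one kernel-verified Lean document; each statement's English description precedes it below -/
import Mathlib

section
/- Suppose m < M. Then V_m and V_M are linear subspaces of V, and they are mutually orthogonal with respect to both inner products: for every u ∈ V_m and v ∈ V_M one has ⟨u,v⟩₁ = 0 and ⟨u,v⟩₂ = 0. -/
/-- An isotropic vector of a positive semidefinite symmetric bilinear form lies in its kernel. -/
theorem LinearMap.mem_ker_iff_apply_self_eq_zero_of_nonneg
    {V : Type*} [AddCommGroup V] [Module ℝ V] (B : V →ₗ[ℝ] V →ₗ[ℝ] ℝ)
    (symm : ∀ u v : V, B u v = B v u) (nonneg : ∀ v : V, 0 ≤ B v v) (u : V) :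
    u ∈ LinearMap.ker B ↔ B u u = 0 := by
  rw [LinearMap.mem_ker]
  refine ⟨fun h => by simp [h], fun h => ?_⟩
  ext w
  by_contra hne
  replace hne : B u w ≠ 0 := hne
  have key := nonneg (w + (-(B w w + 1) / (2 * B u w)) • u)
  simp only [map_add, map_smul, LinearMap.add_apply, LinearMap.smul_apply, smul_eq_mul, h,
    symm w u] at key
  have cancel : -(B w w + 1) / (2 * B u w) * B u w = -(B w w + 1) / 2 := by
    field_simp
  rw [cancel] at key
  linarith

theorem Real.sqrt_eq_mul_sqrt_iff {a b c : ℝ} (ha : 0 ≤ a) (hb : 0 ≤ b) (hc : 0 ≤ c) :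
    √b = c * √a ↔ b = c ^ 2 * a := by
  rw [← sq_eq_sq₀ (Real.sqrt_nonneg b) (by positivity), mul_pow, Real.sq_sqrt ha, Real.sq_sqrt hb]

/-- The Generalized Wielandt Inequality in Inner Product Spaces, Lemma 2.1:
if `m < M` then `V_m` and `V_M` are subspaces, mutually orthogonal with
respect to both inner products. -/
theorem Vm_VM_subspaces_orthogonal
    {V : Type*} [AddCommGroup V] [Module ℝ V]
    (ip1 ip2 : V →ₗ[ℝ] V →ₗ[ℝ] ℝ)
    (symm1 : ∀ u v : V, ip1 u v = ip1 v u)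
    (symm2 : ∀ u v : V, ip2 u v = ip2 v u)
    (pos1 : ∀ v : V, v ≠ 0 → 0 < ip1 v v)
    (pos2 : ∀ v : V, v ≠ 0 → 0 < ip2 v v)
    (m M : ℝ) (hm0 : 0 < m)
    (hm : IsGLB {r : ℝ | ∃ v : V, v ≠ 0 ∧ r = Real.sqrt (ip2 v v) / Real.sqrt (ip1 v v)} m)
    (hM : IsLUB {r : ℝ | ∃ v : V, v ≠ 0 ∧ r = Real.sqrt (ip2 v v) / Real.sqrt (ip1 v v)} M)
    (hmM : m < M) :
    ∃ Sm SM : Submodule ℝ V,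
      (Sm : Set V) = {v : V | Real.sqrt (ip2 v v) = m * Real.sqrt (ip1 v v)} ∧
      (SM : Set V) = {v : V | Real.sqrt (ip2 v v) = M * Real.sqrt (ip1 v v)} ∧
      ∀ u ∈ ({v : V | Real.sqrt (ip2 v v) = m * Real.sqrt (ip1 v v)} : Set V),
        ∀ v ∈ ({v : V | Real.sqrt (ip2 v v) = M * Real.sqrt (ip1 v v)} : Set V),
          ip1 u v = 0 ∧ ip2 u v = 0 := by
  have nonneg1 (v : V) : 0 ≤ ip1 v v := by
    rcases eq_or_ne v 0 with rfl | hv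
    · simp
    · exact (pos1 v hv).le
  have nonneg2 (v : V) : 0 ≤ ip2 v v := by
    rcases eq_or_ne v 0 with rfl | hv
    · simp
    · exact (pos2 v hv).le
  have hM0 : 0 < M := hm0.trans hmM
  have lower (v : V) : m ^ 2 * ip1 v v ≤ ip2 v v := by
    rcases eq_or_ne v 0 with rfl | hv
    · simp
    · have h := hm.1 ⟨v, hv, rfl⟩
      rw [le_div_iff₀ (Real.sqrt_pos.2 (pos1 v hv))] at h
      have h' := pow_le_pow_left₀ (by positivity) h 2
      rwa [mul_pow, Real.sq_sqrt (nonneg1 v), Real.sq_sqrt (nonneg2 v)] at h'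
  have upper (v : V) : ip2 v v ≤ M ^ 2 * ip1 v v := by
    rcases eq_or_ne v 0 with rfl | hv
    · simp
    · have h := hM.1 ⟨v, hv, rfl⟩
      rw [div_le_iff₀ (Real.sqrt_pos.2 (pos1 v hv))] at h
      have h' := pow_le_pow_left₀ (by positivity) h 2
      rwa [mul_pow, Real.sq_sqrt (nonneg1 v), Real.sq_sqrt (nonneg2 v)] at h'
  have mem_ker_lower (v : V) : v ∈ LinearMap.ker (ip2 - m ^ 2 • ip1) ↔
      √(ip2 v v) = m * √(ip1 v v) := by
    rw [LinearMap.mem_ker_iff_apply_self_eq_zero_of_nonneg _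
      (fun u v => by simp [symm1 u v, symm2 u v]) (fun v => by simpa using lower v),
      Real.sqrt_eq_mul_sqrt_iff (nonneg1 v) (nonneg2 v) hm0.le]
    simp [sub_eq_zero]
  have mem_ker_upper (v : V) : v ∈ LinearMap.ker (M ^ 2 • ip1 - ip2) ↔
      √(ip2 v v) = M * √(ip1 v v) := by
    rw [LinearMap.mem_ker_iff_apply_self_eq_zero_of_nonneg _
      (fun u v => by simp [symm1 u v, symm2 u v]) (fun v => by simpa using upper v),
      Real.sqrt_eq_mul_sqrt_iff (nonneg1 v) (nonneg2 v) hM0.le]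
    simpa [sub_eq_zero] using eq_comm
  refine ⟨LinearMap.ker (ip2 - m ^ 2 • ip1), LinearMap.ker (M ^ 2 • ip1 - ip2),
    Set.ext mem_ker_lower, Set.ext mem_ker_upper, fun u hu v hv => ?_⟩
  have hu' := LinearMap.congr_fun (LinearMap.mem_ker.1 ((mem_ker_lower u).2 hu)) v
  have hv' := LinearMap.congr_fun (LinearMap.mem_ker.1 ((mem_ker_upper v).2 hv)) u
  simp only [LinearMap.sub_apply, LinearMap.smul_apply, smul_eq_mul, LinearMap.zero_apply,
    symm1 v u, symm2 v u] at hu' hv'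
  have hsq : m ^ 2 < M ^ 2 := pow_lt_pow_left₀ hmM hm0.le two_ne_zero
  have h1 : ip1 u v = 0 := by
    have h : (M ^ 2 - m ^ 2) * ip1 u v = 0 := by linear_combination hu' + hv'
    exact (mul_eq_zero.1 h).resolve_left (sub_pos.2 hsq).ne'
  exact ⟨h1, by simpa [h1] using hu'⟩
end

section
/- For j = 1, 2 define E_j = {(u,v) : u ≠ 0, v ≠ 0, u/‖u‖_j + v/‖v‖_j ∈ V_m and u/‖u‖_j − v/‖v‖_j ∈ V_M}. Then E₁ = E₂. -/
/-- A vector that is isotropic for a positive semidefinite symmetric bilinear form lies in the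
radical of that form. -/
theorem apply_eq_zero_of_apply_self_eq_zero
    {V : Type*} [AddCommGroup V] [Module ℝ V] (B : V →ₗ[ℝ] V →ₗ[ℝ] ℝ)
    (symm : ∀ u v : V, B u v = B v u) (nonneg : ∀ v : V, 0 ≤ B v v)
    {x : V} (hx : B x x = 0) (w : V) : B x w = 0 := by
  have h := LinearMap.BilinForm.apply_sq_le_of_symm B nonneg ⟨symm⟩ x w
  rw [hx, zero_mul] at h
  exact pow_eq_zero_iff two_ne_zero |>.mp (le_antisymm h (sq_nonneg _))

theorem sqrt_apply_smul_self
    {V : Type*} [AddCommGroup V] [Module ℝ V] (B : V →ₗ[ℝ] V →ₗ[ℝ] ℝ) (k : ℝ) (v : V) :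
    √(B (k • v) (k • v)) = |k| * √(B v v) := by
  have h : B (k • v) (k • v) = k ^ 2 * B v v := by
    simp only [map_smul, LinearMap.smul_apply, smul_eq_mul]
    ring
  rw [h, Real.sqrt_mul (sq_nonneg k), Real.sqrt_sq_eq_abs]

theorem sqrt_apply_smul_self_eq
    {V : Type*} [AddCommGroup V] [Module ℝ V] (P Q : V →ₗ[ℝ] V →ₗ[ℝ] ℝ) {r : ℝ} (k : ℝ) {v : V}
    (h : √(Q v v) = r * √(P v v)) :
    √(Q (k • v) (k • v)) = r * √(P (k • v) (k • v)) := by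
  rw [sqrt_apply_smul_self, sqrt_apply_smul_self, h]
  ring

/-- If `Q` is proportional to `P` on the sum of the `P`-normalizations of `u` and `v`, then
normalizing `u` and `v` with respect to `Q` instead of `P` rescales both by the same factor. -/
theorem exists_inv_sqrt_smul_eq_smul
    {V : Type*} [AddCommGroup V] [Module ℝ V] (P Q : V →ₗ[ℝ] V →ₗ[ℝ] ℝ)
    (symmP : ∀ u v : V, P u v = P v u) (symmQ : ∀ u v : V, Q u v = Q v u)
    (posP : ∀ v : V, v ≠ 0 → 0 < P v v) (posQ : ∀ v : V, v ≠ 0 → 0 < Q v v)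
    {u v : V} (hu : u ≠ 0) (hv : v ≠ 0) (c : ℝ)
    (h : ∀ w : V, Q ((√(P u u))⁻¹ • u + (√(P v v))⁻¹ • v) w =
      c * P ((√(P u u))⁻¹ • u + (√(P v v))⁻¹ • v) w) :
    ∃ k : ℝ, (√(Q u u))⁻¹ • u = k • (√(P u u))⁻¹ • u ∧
      (√(Q v v))⁻¹ • v = k • (√(P v v))⁻¹ • v := by
  have hs := Real.sqrt_pos.mpr (posP u hu)
  have ht := Real.sqrt_pos.mpr (posP v hv)
  have hS := Real.sqrt_pos.mpr (posQ u hu)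
  have hT := Real.sqrt_pos.mpr (posQ v hv)
  have hs2 := Real.sq_sqrt (posP u hu).le
  have ht2 := Real.sq_sqrt (posP v hv).le
  have hS2 := Real.sq_sqrt (posQ u hu).le
  have hT2 := Real.sq_sqrt (posQ v hv).le
  have key := h ((√(P u u))⁻¹ • u - (√(P v v))⁻¹ • v)
  generalize √(P u u) = s at *
  generalize √(P v v) = t at *
  generalize √(Q u u) = S at *
  generalize √(Q v v) = T at *
  simp only [map_add, map_sub, map_smul, LinearMap.add_apply, LinearMap.smul_apply, smul_eq_mul,
    symmP v u, symmQ v u, ← hs2, ← ht2, ← hS2, ← hT2] at key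
  have hsq : (S / s) ^ 2 = (T / t) ^ 2 := by
    have h1 : s⁻¹ * s = 1 := inv_mul_cancel₀ hs.ne'
    have h2 : t⁻¹ * t = 1 := inv_mul_cancel₀ ht.ne'
    rw [div_eq_mul_inv, div_eq_mul_inv]
    linear_combination key + c * (s⁻¹ * s + 1) * h1 - c * (t⁻¹ * t + 1) * h2
  have hST : S / s = T / t :=
    (pow_left_inj₀ (div_pos hS hs).le (div_pos hT ht).le two_ne_zero).mp hsq
  refine ⟨(S / s)⁻¹, ?_, ?_⟩
  · rw [smul_smul]
    congr 1
    field_simp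
  · rw [hST, smul_smul]
    congr 1
    field_simp

/-- Corollary 2.3: the set `E` may equivalently be defined using either norm:
`E₁ = E₂`. -/
theorem E1_eq_E2
    {V : Type*} [AddCommGroup V] [Module ℝ V]
    (ip1 ip2 : V →ₗ[ℝ] V →ₗ[ℝ] ℝ)
    (symm1 : ∀ u v : V, ip1 u v = ip1 v u)
    (symm2 : ∀ u v : V, ip2 u v = ip2 v u)
    (pos1 : ∀ v : V, v ≠ 0 → 0 < ip1 v v)
    (pos2 : ∀ v : V, v ≠ 0 → 0 < ip2 v v)
    (m M : ℝ) (hm0 : 0 < m)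
    (hm : IsGLB {r : ℝ | ∃ v : V, v ≠ 0 ∧ r = Real.sqrt (ip2 v v) / Real.sqrt (ip1 v v)} m)
    (hM : IsLUB {r : ℝ | ∃ v : V, v ≠ 0 ∧ r = Real.sqrt (ip2 v v) / Real.sqrt (ip1 v v)} M) :
    {p : V × V | p.1 ≠ 0 ∧ p.2 ≠ 0 ∧
        ((Real.sqrt (ip1 p.1 p.1))⁻¹ • p.1 + (Real.sqrt (ip1 p.2 p.2))⁻¹ • p.2 ∈
          {v : V | Real.sqrt (ip2 v v) = m * Real.sqrt (ip1 v v)}) ∧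
        ((Real.sqrt (ip1 p.1 p.1))⁻¹ • p.1 - (Real.sqrt (ip1 p.2 p.2))⁻¹ • p.2 ∈
          {v : V | Real.sqrt (ip2 v v) = M * Real.sqrt (ip1 v v)})} =
    {p : V × V | p.1 ≠ 0 ∧ p.2 ≠ 0 ∧
        ((Real.sqrt (ip2 p.1 p.1))⁻¹ • p.1 + (Real.sqrt (ip2 p.2 p.2))⁻¹ • p.2 ∈
          {v : V | Real.sqrt (ip2 v v) = m * Real.sqrt (ip1 v v)}) ∧
        ((Real.sqrt (ip2 p.1 p.1))⁻¹ • p.1 - (Real.sqrt (ip2 p.2 p.2))⁻¹ • p.2 ∈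
          {v : V | Real.sqrt (ip2 v v) = M * Real.sqrt (ip1 v v)})} := by
  have le2 (v : V) : m ^ 2 * ip1 v v ≤ ip2 v v := by
    rcases eq_or_ne v 0 with rfl | hv
    · simp
    have h := hm.1 ⟨v, hv, rfl⟩
    rw [le_div_iff₀ (Real.sqrt_pos.mpr (pos1 v hv))] at h
    have h' := pow_le_pow_left₀ (by positivity) h 2
    rwa [mul_pow, Real.sq_sqrt (pos1 v hv).le, Real.sq_sqrt (pos2 v hv).le] at h'
  have nonneg1 (v : V) : 0 ≤ ip1 v v := by
    rcases eq_or_ne v 0 with rfl | hv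
    · simp
    · exact (pos1 v hv).le
  have nonneg2 (v : V) : 0 ≤ ip2 v v := le_trans (mul_nonneg (sq_nonneg m) (nonneg1 v)) (le2 v)
  have proportional {x : V} (hx : √(ip2 x x) = m * √(ip1 x x)) (w : V) :
      ip2 x w = m ^ 2 * ip1 x w := by
    have hx2 : ip2 x x = m ^ 2 * ip1 x x := by
      rw [← Real.sq_sqrt (nonneg2 x), hx, mul_pow, Real.sq_sqrt (nonneg1 x)]
    have h := apply_eq_zero_of_apply_self_eq_zero (ip2 - m ^ 2 • ip1)
      (fun u v => by simp [symm1 u v, symm2 u v]) (fun v => by simpa using le2 v)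
      (x := x) (by simp [hx2]) w
    simpa [sub_eq_zero] using h
  ext ⟨u, v⟩
  constructor
  · rintro ⟨hu, hv, hp, hq⟩
    obtain ⟨k, h1, h2⟩ := exists_inv_sqrt_smul_eq_smul ip1 ip2 symm1 symm2 pos1 pos2 hu hv (m ^ 2)
      (proportional hp)
    refine ⟨hu, hv, ?_, ?_⟩
    · rw [h1, h2, ← smul_add]
      exact sqrt_apply_smul_self_eq ip1 ip2 k hp
    · rw [h1, h2, ← smul_sub]
      exact sqrt_apply_smul_self_eq ip1 ip2 k hq
  · rintro ⟨hu, hv, hp, hq⟩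
    obtain ⟨k, h1, h2⟩ := exists_inv_sqrt_smul_eq_smul ip2 ip1 symm2 symm1 pos2 pos1 hu hv
      (m ^ 2)⁻¹ (fun w => by rw [proportional hp w, inv_mul_cancel_left₀ (pow_pos hm0 2).ne'])
    refine ⟨hu, hv, ?_, ?_⟩
    · rw [h1, h2, ← smul_add]
      exact sqrt_apply_smul_self_eq ip1 ip2 k hp
    · rw [h1, h2, ← smul_sub]
      exact sqrt_apply_smul_self_eq ip1 ip2 k hq
end

section
/- For linearly independent vectors u and v in V, with φ and ψ the angles between u and v with respect to ⟨·,·⟩₁ and ⟨·,·⟩₂ respectively, one has (m/M)·tan(φ/2) ≤ tan(ψ/2) ≤ (M/m)·tan(φ/2). -/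
/-- The discriminant estimate behind `tan_half_angle_bounds`: `P`, `Q`, `R` are the entries of the
second Gram matrix of two vectors orthogonal for the first inner product, whose first squared norms
are `A` and `B`. -/
lemma discriminant_estimate {P Q R A B m M s : ℝ} (hm : 0 < m) (hM : 0 < M) (hA : 0 < A)
    (hB : 0 < B) (hP : 0 < P) (hPA : P ≤ M ^ 2 * A) (hQB : m ^ 2 * B ≤ Q)
    (hD : m ^ 2 * (P * B) ≤ P * Q - R ^ 2) (hs : 0 ≤ s)
    (hs2 : s ^ 2 = (P + Q) ^ 2 - 4 * R ^ 2) :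
    m ^ 2 * B * (s + (P - Q)) ≤ M ^ 2 * A * (s - (P - Q)) := by
  have hmB : 0 < m ^ 2 * B := by positivity
  have hMA : 0 < M ^ 2 * A := by positivity
  have hQ : 0 < Q := hmB.trans_le hQB
  set D := P * Q - R ^ 2 with hDdef
  have hD0 : 0 < D := lt_of_lt_of_le (by positivity) hD
  set κ := m ^ 2 * B / (M ^ 2 * A) with hκ
  have hκ0 : 0 < κ := by positivity
  have hκA : κ * (M ^ 2 * A) = m ^ 2 * B := by rw [hκ]; field_simp
  set k := √(κ * D) with hk
  have hk0 : 0 ≤ k := Real.sqrt_nonneg _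
  have hk2 : k ^ 2 = κ * D := Real.sq_sqrt (by positivity)
  have hκP : κ * P ≤ m ^ 2 * B := by
    rw [← hκA]; exact mul_le_mul_of_nonneg_left hPA hκ0.le
  have hkQ : k ≤ Q := by
    refine abs_le_of_sq_le_sq' ?_ hQ.le |>.2
    calc k ^ 2 = κ * D := hk2
      _ ≤ κ * (P * Q) := by gcongr; rw [hDdef]; nlinarith [sq_nonneg R]
      _ = κ * P * Q := by ring
      _ ≤ Q * Q := by gcongr; exact hκP.trans hQB
      _ = Q ^ 2 := by ring
  have hkP : k * P ≤ D := by
    refine abs_le_of_sq_le_sq' ?_ hD0.le |>.2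
    calc (k * P) ^ 2 = κ * P * P * D := by rw [mul_pow, hk2]; ring
      _ ≤ m ^ 2 * B * P * D := by gcongr
      _ = m ^ 2 * (P * B) * D := by ring
      _ ≤ D * D := by gcongr
      _ = D ^ 2 := by ring
  have hst : P - Q + 2 * k ≤ s := by
    refine abs_le_of_sq_le_sq' ?_ hs |>.2
    rw [hs2]
    nlinarith [mul_nonneg hk0 (sub_nonneg.2 hkQ)]
  have hsum : 0 < s + (P - Q) ∧ 0 < s - (P - Q) := by
    have := abs_lt_of_sq_lt_sq (a := P - Q) (b := s) (by rw [hs2]; nlinarith) hs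
    rw [abs_lt] at this
    constructor <;> linarith
  have hκs : κ * (s + (P - Q)) ≤ s - (P - Q) := by
    have h1 : (2 * k) ^ 2 ≤ (s - (P - Q)) ^ 2 := by gcongr; linarith
    have h2 : (2 * k) ^ 2 = κ * (s + (P - Q)) * (s - (P - Q)) := by
      have : (s + (P - Q)) * (s - (P - Q)) = 4 * D := by rw [hDdef]; linear_combination hs2
      rw [mul_assoc, this, mul_pow, hk2]; ring
    rw [h2, sq] at h1
    exact le_of_mul_le_mul_right h1 hsum.2
  calc m ^ 2 * B * (s + (P - Q)) = M ^ 2 * A * (κ * (s + (P - Q))) := by rw [← hκA]; ring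
    _ ≤ _ := by gcongr

lemma mul_tan_half_le_tan_half {m M φ ψ : ℝ} (hM : 0 < M) (hψ : ψ ∈ Set.Icc 0 Real.pi)
    (hcφ : 0 < 1 + Real.cos φ) (hcψ : 0 < 1 + Real.cos ψ)
    (h : m ^ 2 * (1 - Real.cos φ) * (1 + Real.cos ψ) ≤
      M ^ 2 * (1 + Real.cos φ) * (1 - Real.cos ψ)) :
    m / M * Real.tan (φ / 2) ≤ Real.tan (ψ / 2) := by
  have key : ∀ θ : ℝ, 0 < 1 + Real.cos θ →
      Real.tan (θ / 2) ^ 2 = (1 - Real.cos θ) / (1 + Real.cos θ) := by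
    intro θ hθ
    have hc : Real.cos θ = 2 * Real.cos (θ / 2) ^ 2 - 1 := by
      rw [← Real.cos_two_mul]; congr 1; ring
    have h0 : Real.cos (θ / 2) ≠ 0 := by
      intro h0; rw [hc, h0] at hθ; norm_num at hθ
    rw [Real.tan_eq_sin_div_cos, div_pow, Real.sin_sq, hc]
    field_simp
    ring
  have hψ0 : 0 ≤ Real.tan (ψ / 2) :=
    Real.tan_nonneg_of_nonneg_of_le_pi_div_two (by linarith [hψ.1]) (by linarith [hψ.2])
  refine abs_le_of_sq_le_sq' ?_ hψ0 |>.2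
  rw [mul_pow, key φ hcφ, key ψ hcψ, div_pow, div_mul_div_comm,
    div_le_div_iff₀ (by positivity) hcψ]
  linarith

section InnerProducts

variable {V : Type*} [AddCommGroup V] [Module ℝ V]

lemma add_smul_ne_zero_of_linearIndependent {u v : V} (huv : LinearIndependent ℝ ![u, v])
    {a b : ℝ} (ha : a ≠ 0) : a • u + b • v ≠ 0 :=
  fun h => ha (LinearIndependent.pair_iff.1 huv a b h).1

lemma one_add_cos_pos (ip : V →ₗ[ℝ] V →ₗ[ℝ] ℝ) (symm : ∀ u v : V, ip u v = ip v u)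
    (pos : ∀ v : V, v ≠ 0 → 0 < ip v v) {u v : V} (huv : LinearIndependent ℝ ![u, v]) :
    0 < 1 + ip u v / (√(ip u u) * √(ip v v)) := by
  have hu := pos u (by simpa using huv.ne_zero 0)
  have hv := pos v (by simpa using huv.ne_zero 1)
  have ha := Real.sqrt_pos.2 hu
  have hb := Real.sqrt_pos.2 hv
  have h := pos _ (add_smul_ne_zero_of_linearIndependent huv (b := √(ip u u)) hb.ne')
  simp only [map_add, map_smul, LinearMap.add_apply, LinearMap.smul_apply, smul_eq_mul,
    symm v u] at h
  have hua := Real.sq_sqrt hu.le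
  have hvb := Real.sq_sqrt hv.le
  generalize √(ip u u) = a at *
  generalize √(ip v v) = b at *
  rw [← hua, ← hvb] at h
  have h2 : 0 < 2 * (a * b) * (a * b + ip u v) := by linarith
  have h3 := (pos_iff_pos_of_mul_pos h2).1 (by positivity)
  have : 1 + ip u v / (a * b) = (a * b + ip u v) / (a * b) := by field_simp
  rw [this]
  positivity

/-- The comparison of half-angles for vectors of unit length in the first inner product. -/
lemma half_angle_comparison_of_unit (ip1 ip2 : V →ₗ[ℝ] V →ₗ[ℝ] ℝ)
    (symm1 : ∀ u v : V, ip1 u v = ip1 v u) (symm2 : ∀ u v : V, ip2 u v = ip2 v u)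
    (pos1 : ∀ v : V, v ≠ 0 → 0 < ip1 v v) (pos2 : ∀ v : V, v ≠ 0 → 0 < ip2 v v)
    {m M : ℝ} (hm : 0 < m) (hM : 0 < M)
    (lower : ∀ v : V, m ^ 2 * ip1 v v ≤ ip2 v v) (upper : ∀ v : V, ip2 v v ≤ M ^ 2 * ip1 v v)
    {u v : V} (huv : LinearIndependent ℝ ![u, v]) (hu : ip1 u u = 1) (hv : ip1 v v = 1)
    {s : ℝ} (hs : 0 ≤ s) (hs2 : s ^ 2 = ip2 u u * ip2 v v) :
    m ^ 2 * (1 - ip1 u v) * (s + ip2 u v) ≤ M ^ 2 * (1 + ip1 u v) * (s - ip2 u v) := by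
  have hp : u + v ≠ 0 := by
    simpa using add_smul_ne_zero_of_linearIndependent huv (b := 1) one_ne_zero
  have hq : u - v ≠ 0 := by
    simpa [sub_eq_add_neg] using
      add_smul_ne_zero_of_linearIndependent huv (b := -1) one_ne_zero
  have hA : ip1 (u + v) (u + v) = 2 * (1 + ip1 u v) := by
    simp only [map_add, LinearMap.add_apply, symm1 v u, hu, hv]; ring
  have hB : ip1 (u - v) (u - v) = 2 * (1 - ip1 u v) := by
    simp only [map_sub, LinearMap.sub_apply, symm1 v u, hu, hv]; ring
  have hC : ip1 (u + v) (u - v) = 0 := by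
    simp only [map_sub, map_add, LinearMap.add_apply, symm1 v u, hu, hv]; ring
  have hP : ip2 (u + v) (u + v) = ip2 u u + ip2 v v + 2 * ip2 u v := by
    simp only [map_add, LinearMap.add_apply, symm2 v u]; ring
  have hQ : ip2 (u - v) (u - v) = ip2 u u + ip2 v v - 2 * ip2 u v := by
    simp only [map_sub, LinearMap.sub_apply, symm2 v u]; ring
  have hR : ip2 (u + v) (u - v) = ip2 u u - ip2 v v := by
    simp only [map_sub, map_add, LinearMap.add_apply, symm2 v u]; ring
  have hA0 := pos1 _ hp
  have hP0 := pos2 _ hp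
  have hD : m ^ 2 * (ip2 (u + v) (u + v) * ip1 (u - v) (u - v)) ≤
      ip2 (u + v) (u + v) * ip2 (u - v) (u - v) - ip2 (u + v) (u - v) ^ 2 := by
    have h := lower (ip2 (u + v) (u + v) • (u - v) - ip2 (u + v) (u - v) • (u + v))
    generalize u + v = p at *
    generalize u - v = q at *
    simp only [map_sub, map_smul, LinearMap.sub_apply, LinearMap.smul_apply, smul_eq_mul,
      symm1 q p, symm2 q p, hC] at h
    refine le_of_mul_le_mul_left ?_ hP0
    have : 0 ≤ m ^ 2 * (ip2 p q ^ 2 * ip1 p p) := by positivity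
    linarith
  have h := discriminant_estimate hm hM hA0 (pos1 _ hq) hP0 (upper _) (lower _) hD
    (s := 4 * s) (by positivity) (by rw [hP, hQ, hR]; linear_combination 16 * hs2)
  rw [hA, hB, hP, hQ] at h
  linarith

lemma half_angle_comparison (ip1 ip2 : V →ₗ[ℝ] V →ₗ[ℝ] ℝ)
    (symm1 : ∀ u v : V, ip1 u v = ip1 v u) (symm2 : ∀ u v : V, ip2 u v = ip2 v u)
    (pos1 : ∀ v : V, v ≠ 0 → 0 < ip1 v v) (pos2 : ∀ v : V, v ≠ 0 → 0 < ip2 v v)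
    {m M : ℝ} (hm : 0 < m) (hM : 0 < M)
    (lower : ∀ v : V, m ^ 2 * ip1 v v ≤ ip2 v v) (upper : ∀ v : V, ip2 v v ≤ M ^ 2 * ip1 v v)
    {u v : V} (huv : LinearIndependent ℝ ![u, v]) :
    m ^ 2 * (1 - ip1 u v / (√(ip1 u u) * √(ip1 v v))) *
        (1 + ip2 u v / (√(ip2 u u) * √(ip2 v v))) ≤
      M ^ 2 * (1 + ip1 u v / (√(ip1 u u) * √(ip1 v v))) *
        (1 - ip2 u v / (√(ip2 u u) * √(ip2 v v))) := by
  have hu0 : u ≠ 0 := by simpa using huv.ne_zero 0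
  have hv0 : v ≠ 0 := by simpa using huv.ne_zero 1
  have ha := Real.sqrt_pos.2 (pos1 u hu0)
  have hb := Real.sqrt_pos.2 (pos1 v hv0)
  have hc := Real.sqrt_pos.2 (pos2 u hu0)
  have hd := Real.sqrt_pos.2 (pos2 v hv0)
  have ha2 := Real.sq_sqrt (pos1 u hu0).le
  have hb2 := Real.sq_sqrt (pos1 v hv0).le
  have hc2 := Real.sq_sqrt (pos2 u hu0).le
  have hd2 := Real.sq_sqrt (pos2 v hv0).le
  generalize √(ip1 u u) = a at *
  generalize √(ip1 v v) = b at *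
  generalize √(ip2 u u) = c at *
  generalize √(ip2 v v) = d at *
  have hind : LinearIndependent ℝ ![a⁻¹ • u, b⁻¹ • v] := by
    rw [LinearIndependent.pair_iff] at huv ⊢
    intro x y hxy
    rw [smul_smul, smul_smul] at hxy
    simpa [ha.ne', hb.ne'] using huv _ _ hxy
  have h := half_angle_comparison_of_unit ip1 ip2 symm1 symm2 pos1 pos2 hm hM lower upper hind
    (by simp only [map_smul, LinearMap.smul_apply, smul_eq_mul, ← ha2]; field_simp)
    (by simp only [map_smul, LinearMap.smul_apply, smul_eq_mul, ← hb2]; field_simp)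
    (s := c * d / (a * b)) (by positivity)
    (by simp only [map_smul, LinearMap.smul_apply, smul_eq_mul, ← hc2, ← hd2]; field_simp)
  simp only [map_smul, LinearMap.smul_apply, smul_eq_mul] at h
  have e1 : a⁻¹ * (b⁻¹ * ip1 u v) = ip1 u v / (a * b) := by field_simp
  have e2 : c * d / (a * b) + a⁻¹ * (b⁻¹ * ip2 u v) =
      (1 + ip2 u v / (c * d)) * (c * d / (a * b)) := by field_simp
  have e3 : c * d / (a * b) - a⁻¹ * (b⁻¹ * ip2 u v) =
      (1 - ip2 u v / (c * d)) * (c * d / (a * b)) := by field_simp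
  simp only [mul_left_comm b⁻¹ a⁻¹] at h
  rw [e1, e2, e3, ← mul_assoc, ← mul_assoc] at h
  exact le_of_mul_le_mul_right h (by positivity)

end InnerProducts

/-- Theorem 2.4 (main inequality): for independent vectors `u, v`, with angles
`φ` and `ψ` with respect to the two inner products,
`(m/M)·tan(φ/2) ≤ tan(ψ/2) ≤ (M/m)·tan(φ/2)`. -/
theorem tan_half_angle_bounds
    {V : Type*} [AddCommGroup V] [Module ℝ V]
    (ip1 ip2 : V →ₗ[ℝ] V →ₗ[ℝ] ℝ)
    (symm1 : ∀ u v : V, ip1 u v = ip1 v u)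
    (symm2 : ∀ u v : V, ip2 u v = ip2 v u)
    (pos1 : ∀ v : V, v ≠ 0 → 0 < ip1 v v)
    (pos2 : ∀ v : V, v ≠ 0 → 0 < ip2 v v)
    (m M : ℝ) (hm0 : 0 < m)
    (hm : IsGLB {r : ℝ | ∃ v : V, v ≠ 0 ∧ r = Real.sqrt (ip2 v v) / Real.sqrt (ip1 v v)} m)
    (hM : IsLUB {r : ℝ | ∃ v : V, v ≠ 0 ∧ r = Real.sqrt (ip2 v v) / Real.sqrt (ip1 v v)} M)
    (u v : V) (huv : LinearIndependent ℝ ![u, v])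
    (φ ψ : ℝ) (hφ : φ ∈ Set.Icc 0 Real.pi) (hψ : ψ ∈ Set.Icc 0 Real.pi)
    (hcosφ : Real.cos φ = ip1 u v / (Real.sqrt (ip1 u u) * Real.sqrt (ip1 v v)))
    (hcosψ : Real.cos ψ = ip2 u v / (Real.sqrt (ip2 u u) * Real.sqrt (ip2 v v))) :
    m / M * Real.tan (φ / 2) ≤ Real.tan (ψ / 2) ∧
    Real.tan (ψ / 2) ≤ M / m * Real.tan (φ / 2) := by
  have hu0 : u ≠ 0 := by simpa using huv.ne_zero 0
  have hmM : m ≤ M := (hm.1 ⟨u, hu0, rfl⟩).trans (hM.1 ⟨u, hu0, rfl⟩)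
  have hM0 : 0 < M := hm0.trans_le hmM
  have lower : ∀ w : V, m ^ 2 * ip1 w w ≤ ip2 w w := by
    intro w
    rcases eq_or_ne w 0 with rfl | hw
    · simp
    have h := hm.1 ⟨w, hw, rfl⟩
    rw [← Real.sqrt_div' _ (pos1 w hw).le, Real.le_sqrt hm0.le
      (div_nonneg (pos2 w hw).le (pos1 w hw).le), le_div_iff₀ (pos1 w hw)] at h
    exact h
  have upper : ∀ w : V, ip2 w w ≤ M ^ 2 * ip1 w w := by
    intro w
    rcases eq_or_ne w 0 with rfl | hw
    · simp
    have h := hM.1 ⟨w, hw, rfl⟩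
    rw [← Real.sqrt_div' _ (pos1 w hw).le, Real.sqrt_le_left hM0.le,
      div_le_iff₀ (pos1 w hw)] at h
    exact h
  have hneg : LinearIndependent ℝ ![u, -v] := by
    rw [LinearIndependent.pair_iff] at huv ⊢
    intro x y hxy
    simpa using huv x (-y) (by simpa using hxy)
  have hcφ : 0 < 1 + Real.cos φ := hcosφ ▸ one_add_cos_pos ip1 symm1 pos1 huv
  have hcψ : 0 < 1 + Real.cos ψ := hcosψ ▸ one_add_cos_pos ip2 symm2 pos2 huv
  have h1 := half_angle_comparison ip1 ip2 symm1 symm2 pos1 pos2 hm0 hM0 lower upper huv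
  have h2 := half_angle_comparison ip1 ip2 symm1 symm2 pos1 pos2 hm0 hM0 lower upper hneg
  simp only [map_neg, LinearMap.neg_apply, neg_neg, neg_div, sub_neg_eq_add,
    ← sub_eq_add_neg] at h2
  rw [← hcosφ, ← hcosψ] at h1 h2
  refine ⟨mul_tan_half_le_tan_half hM0 hψ hcφ hcψ h1, ?_⟩
  have h3 := mul_tan_half_le_tan_half (m := m) hM0 hφ hcψ hcφ (by linarith)
  rw [div_mul_eq_mul_div, div_le_iff₀ hM0] at h3
  rw [div_mul_eq_mul_div, le_div_iff₀ hm0]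
  linarith
end

section
/- For linearly independent vectors u and v in V, with φ and ψ the angles between u and v with respect to ⟨·,·⟩₁ and ⟨·,·⟩₂ respectively, equality tan(ψ/2) = (M/m)·tan(φ/2) holds if and only if (u,v) ∈ E. -/
section HalfAngle

variable {V : Type*} [AddCommGroup V] [Module ℝ V]

/-- The squared tangent of half the angle between `u` and `v` with respect to `g`. -/
noncomputable def sqTanHalf (g : V →ₗ[ℝ] V →ₗ[ℝ] ℝ) (u v : V) : ℝ :=
  (√(g u u) * √(g v v) - g u v) / (√(g u u) * √(g v v) + g u v)

/-- Some positive multiples of `u` and `v` have equal `g`-length, their sum realizes the lower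
bound `k` of the ratio of `h` to `g`, and their difference realizes the upper bound `K`. -/
def IsExtremalPair (g h : V →ₗ[ℝ] V →ₗ[ℝ] ℝ) (k K : ℝ) (u v : V) : Prop :=
  ∃ s t : ℝ, 0 < s ∧ 0 < t ∧ s ^ 2 * g u u = t ^ 2 * g v v ∧
    h (s • u + t • v) (s • u + t • v) = k * g (s • u + t • v) (s • u + t • v) ∧
    h (s • u - t • v) (s • u - t • v) = K * g (s • u - t • v) (s • u - t • v)

/-- `g` is a symmetric positive definite form. -/
structure IsInnerForm (g : V →ₗ[ℝ] V →ₗ[ℝ] ℝ) : Prop where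
  symm : ∀ u v, g u v = g v u
  pos : ∀ v, v ≠ 0 → 0 < g v v

/-- The ratio of `h` to `g` lies between `k` and `K`. -/
structure IsBoundedBy (g h : V →ₗ[ℝ] V →ₗ[ℝ] ℝ) (k K : ℝ) : Prop where
  lower : ∀ w, k * g w w ≤ h w w
  upper : ∀ w, h w w ≤ K * g w w

theorem IsInnerForm.add_self {g : V →ₗ[ℝ] V →ₗ[ℝ] ℝ} (hg : IsInnerForm g) (u v : V) (s t : ℝ) :
    g (s • u + t • v) (s • u + t • v) = s ^ 2 * g u u + t ^ 2 * g v v + 2 * (s * t) * g u v := by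
  simp only [map_add, map_smul, LinearMap.add_apply, LinearMap.smul_apply, smul_eq_mul,
    hg.symm v u]
  ring

theorem IsInnerForm.sub_self {g : V →ₗ[ℝ] V →ₗ[ℝ] ℝ} (hg : IsInnerForm g) (u v : V) (s t : ℝ) :
    g (s • u - t • v) (s • u - t • v) = s ^ 2 * g u u + t ^ 2 * g v v - 2 * (s * t) * g u v := by
  simp only [map_sub, map_smul, LinearMap.sub_apply, LinearMap.smul_apply, smul_eq_mul,
    hg.symm v u]
  ring

theorem smul_add_smul_ne_zero {u v : V} (huv : LinearIndependent ℝ ![u, v]) {s : ℝ} (hs : s ≠ 0)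
    (t : ℝ) : s • u + t • v ≠ 0 := fun h =>
  hs (LinearIndependent.pair_iff.mp huv s t h).1

theorem smul_sub_smul_ne_zero {u v : V} (huv : LinearIndependent ℝ ![u, v]) {s : ℝ} (hs : s ≠ 0)
    (t : ℝ) : s • u - t • v ≠ 0 := by
  simpa [sub_eq_add_neg] using smul_add_smul_ne_zero huv hs (-t)

theorem IsInnerForm.sqrt_pos {g : V →ₗ[ℝ] V →ₗ[ℝ] ℝ} (hg : IsInnerForm g) {u v : V}
    (huv : LinearIndependent ℝ ![u, v]) : 0 < √(g u u) ∧ 0 < √(g v v) :=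
  ⟨Real.sqrt_pos.2 (hg.pos u (by simpa using huv.ne_zero 0)),
    Real.sqrt_pos.2 (hg.pos v (by simpa using huv.ne_zero 1))⟩

theorem IsInnerForm.sq_sqrt {g : V →ₗ[ℝ] V →ₗ[ℝ] ℝ} (hg : IsInnerForm g) (u : V) :
    √(g u u) ^ 2 = g u u := by
  refine Real.sq_sqrt ?_
  rcases eq_or_ne u 0 with rfl | h
  · simp
  · exact (hg.pos u h).le

theorem IsInnerForm.strict_cauchy_schwarz {g : V →ₗ[ℝ] V →ₗ[ℝ] ℝ} (hg : IsInnerForm g) {u v : V}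
    (huv : LinearIndependent ℝ ![u, v]) :
    0 < √(g u u) * √(g v v) - g u v ∧ 0 < √(g u u) * √(g v v) + g u v := by
  obtain ⟨ha, hb⟩ := hg.sqrt_pos huv
  have h1 := hg.pos _ (smul_add_smul_ne_zero huv hb.ne' (√(g u u)))
  have h2 := hg.pos _ (smul_sub_smul_ne_zero huv hb.ne' (√(g u u)))
  rw [hg.add_self, ← hg.sq_sqrt u, ← hg.sq_sqrt v] at h1
  rw [hg.sub_self, ← hg.sq_sqrt u, ← hg.sq_sqrt v] at h2
  simp only [Real.sqrt_sq ha.le, Real.sqrt_sq hb.le] at h1 h2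
  have hab := mul_pos ha hb
  constructor
  · refine pos_of_mul_pos_right (a := 2 * (√(g u u) * √(g v v))) ?_ (by positivity)
    linarith
  · refine pos_of_mul_pos_right (a := 2 * (√(g u u) * √(g v v))) ?_ (by positivity)
    linarith

theorem IsInnerForm.sqTanHalf_pos {g : V →ₗ[ℝ] V →ₗ[ℝ] ℝ} (hg : IsInnerForm g) {u v : V}
    (huv : LinearIndependent ℝ ![u, v]) : 0 < sqTanHalf g u v :=
  div_pos (hg.strict_cauchy_schwarz huv).1 (hg.strict_cauchy_schwarz huv).2

theorem sqTanHalf_neg_right (g : V →ₗ[ℝ] V →ₗ[ℝ] ℝ) (u v : V) :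
    sqTanHalf g u (-v) = (sqTanHalf g u v)⁻¹ := by
  simp [sqTanHalf, sub_eq_add_neg]

theorem linearIndependent_pair_neg_right {u v : V} (huv : LinearIndependent ℝ ![u, v]) :
    LinearIndependent ℝ ![u, -v] := by
  rw [LinearIndependent.pair_iff] at huv ⊢
  intro s t h
  simpa using huv s (-t) (by simpa using h)

/-- A vector at which a positive semidefinite form vanishes lies in its radical. -/
theorem eq_zero_of_self_eq_zero {p : V →ₗ[ℝ] V →ₗ[ℝ] ℝ} (hs : ∀ u v, p u v = p v u)
    (hp : ∀ w, 0 ≤ p w w) {w : V} (hw : p w w = 0) (z : V) : p w z = 0 := by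
  by_contra hne
  have h := hp ((-(p z z + 1) / (2 * p w z)) • w + z)
  simp only [map_add, map_smul, LinearMap.add_apply, LinearMap.smul_apply, smul_eq_mul,
    hs z w, hw] at h
  have h2 : -(p z z + 1) / (2 * p w z) * p w z = -(p z z + 1) / 2 := by field_simp
  linarith

theorem IsBoundedBy.apply_eq_of_lower_eq {g h : V →ₗ[ℝ] V →ₗ[ℝ] ℝ} {k K : ℝ} (hg : IsInnerForm g)
    (hh : IsInnerForm h) (hb : IsBoundedBy g h k K) {w : V} (hw : h w w = k * g w w) (z : V) :
    h w z = k * g w z := by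
  have := eq_zero_of_self_eq_zero (p := h - k • g) (w := w)
    (fun u v => by simp [hg.symm u v, hh.symm u v])
    (fun w => by simpa using hb.lower w) (by simp [hw]) z
  simpa [sub_eq_zero] using this

theorem IsInnerForm.apply_add_sub {g : V →ₗ[ℝ] V →ₗ[ℝ] ℝ} (hg : IsInnerForm g) (u v : V)
    (s t : ℝ) : g (s • u + t • v) (s • u - t • v) = s ^ 2 * g u u - t ^ 2 * g v v := by
  simp only [map_add, map_sub, map_smul, LinearMap.add_apply, LinearMap.smul_apply, smul_eq_mul,
    hg.symm v u]
  ring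

theorem IsBoundedBy.sq_mul_eq_iff {g h : V →ₗ[ℝ] V →ₗ[ℝ] ℝ} {k K : ℝ} (hg : IsInnerForm g)
    (hh : IsInnerForm h) (hk : 0 < k) (hb : IsBoundedBy g h k K) {u v : V} {s t : ℝ}
    (hw : h (s • u + t • v) (s • u + t • v) = k * g (s • u + t • v) (s • u + t • v)) :
    s ^ 2 * h u u = t ^ 2 * h v v ↔ s ^ 2 * g u u = t ^ 2 * g v v := by
  have h1 := hb.apply_eq_of_lower_eq hg hh hw (s • u - t • v)
  rw [hg.apply_add_sub, hh.apply_add_sub] at h1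
  rw [← sub_eq_zero, h1, mul_eq_zero, sub_eq_zero]
  simp [hk.ne']

theorem IsBoundedBy.symm {g h : V →ₗ[ℝ] V →ₗ[ℝ] ℝ} {k K : ℝ} (hk : 0 < k) (hK : 0 < K)
    (hb : IsBoundedBy g h k K) : IsBoundedBy h g K⁻¹ k⁻¹ where
  lower w := by rw [inv_mul_le_iff₀ hK]; exact hb.upper w
  upper w := by rw [← div_eq_inv_mul, le_div_iff₀' hk]; exact hb.lower w

theorem IsBoundedBy.sqTanHalf_le_of_nonneg {g h : V →ₗ[ℝ] V →ₗ[ℝ] ℝ} {k K : ℝ}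
    (hg : IsInnerForm g) (hh : IsInnerForm h) (hk : 0 < k) (hK : 0 < K)
    (hb : IsBoundedBy g h k K) {u v : V} (huv : LinearIndependent ℝ ![u, v]) (hC : 0 ≤ h u v) :
    sqTanHalf h u v ≤ K / k * sqTanHalf g u v ∧
      (sqTanHalf h u v = K / k * sqTanHalf g u v → IsExtremalPair g h k K u v) := by
  obtain ⟨ha, hb'⟩ := hg.sqrt_pos huv
  obtain ⟨hA, hB⟩ := hh.sqrt_pos huv
  obtain ⟨hm1, hp1⟩ := hg.strict_cauchy_schwarz huv
  obtain ⟨hm2, hp2⟩ := hh.strict_cauchy_schwarz huv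
  have low := hb.lower (√(g v v) • u + √(g u u) • v)
  have upp := hb.upper (√(g v v) • u - √(g u u) • v)
  have gp : g (√(g v v) • u + √(g u u) • v) (√(g v v) • u + √(g u u) • v) =
      2 * (√(g u u) * √(g v v)) * (√(g u u) * √(g v v) + g u v) := by
    rw [hg.add_self, hg.sq_sqrt, hg.sq_sqrt]
    linear_combination (-2 * √(g v v) ^ 2) * hg.sq_sqrt u - 2 * g u u * hg.sq_sqrt v
  have gm : g (√(g v v) • u - √(g u u) • v) (√(g v v) • u - √(g u u) • v) =
      2 * (√(g u u) * √(g v v)) * (√(g u u) * √(g v v) - g u v) := by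
    rw [hg.sub_self, hg.sq_sqrt, hg.sq_sqrt]
    linear_combination (-2 * √(g v v) ^ 2) * hg.sq_sqrt u - 2 * g u u * hg.sq_sqrt v
  have hp := hh.add_self u v (√(g v v)) (√(g u u))
  have hm := hh.sub_self u v (√(g v v)) (√(g u u))
  have hpos := hh.pos _ (smul_add_smul_ne_zero huv hb'.ne' (√(g u u)))
  have hsq : √(g v v) ^ 2 * g u u = √(g u u) ^ 2 * g v v := by
    rw [hg.sq_sqrt, hg.sq_sqrt]; ring
  rw [← hh.sq_sqrt u, ← hh.sq_sqrt v] at hp hm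
  unfold sqTanHalf IsExtremalPair
  set a := √(g u u)
  set b := √(g v v)
  set A := √(h u u)
  set B := √(h v v)
  set hP := h (b • u + a • v) (b • u + a • v)
  set hM := h (b • u - a • v) (b • u - a • v)
  set gP := g (b • u + a • v) (b • u + a • v)
  set gM := g (b • u - a • v) (b • u - a • v)
  have hab := mul_pos ha hb'
  have gPpos : 0 < gP := by rw [gp]; positivity
  have gMpos : 0 < gM := by rw [gm]; positivity
  have ratio : (a * b - g u v) / (a * b + g u v) = gM / gP := by
    rw [gp, gm, mul_div_mul_left _ _ (by positivity)]
  have step1 : (A * B - h u v) / (A * B + h u v) ≤ hM / hP := by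
    rw [div_le_div_iff₀ hp2 hpos, hp, hm]
    nlinarith [mul_nonneg hC (sq_nonneg (b * A - a * B))]
  have eqn : K / k * (gM / gP) = (K * gM) / (k * gP) := by rw [div_mul_div_comm]
  have step2 : hM / hP ≤ (K * gM) / (k * gP) := by gcongr
  rw [ratio, eqn]
  refine ⟨step1.trans step2, fun heq => ⟨b, a, hb', ha, hsq, ?_⟩⟩
  have h3 : hM / hP = (K * gM) / (k * gP) := le_antisymm step2 (heq ▸ step1)
  rw [div_eq_div_iff hpos.ne' (by positivity)] at h3
  have hkg : 0 < k * gP := by positivity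
  have hKg : 0 < K * gM := by positivity
  constructor
  · refine le_antisymm ?_ low
    refine le_of_mul_le_mul_left ?_ hKg
    rw [← h3]
    gcongr
  · refine le_antisymm upp ?_
    refine le_of_mul_le_mul_right ?_ hkg
    rw [h3]
    gcongr

theorem IsBoundedBy.sqTanHalf_le_of_nonpos {g h : V →ₗ[ℝ] V →ₗ[ℝ] ℝ} {k K : ℝ}
    (hg : IsInnerForm g) (hh : IsInnerForm h) (hk : 0 < k) (hK : 0 < K)
    (hb : IsBoundedBy g h k K) {u v : V} (huv : LinearIndependent ℝ ![u, v]) (hc : g u v ≤ 0) :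
    sqTanHalf h u v ≤ K / k * sqTanHalf g u v ∧
      (sqTanHalf h u v = K / k * sqTanHalf g u v → IsExtremalPair g h k K u v) := by
  have hTg := hg.sqTanHalf_pos huv
  have hTh := hh.sqTanHalf_pos huv
  obtain ⟨h1, h2⟩ := (hb.symm hk hK).sqTanHalf_le_of_nonneg hh hg (inv_pos.2 hK) (inv_pos.2 hk)
    (linearIndependent_pair_neg_right huv) (by simpa using hc)
  rw [sqTanHalf_neg_right, sqTanHalf_neg_right] at h1 h2
  have e : k⁻¹ / K⁻¹ * (sqTanHalf h u v)⁻¹ = K / k * (sqTanHalf h u v)⁻¹ := by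
    field_simp
  rw [e] at h1 h2
  constructor
  · rw [← div_eq_mul_inv, inv_eq_one_div, div_le_div_iff₀ hTg hTh] at h1
    simpa using h1
  · intro heq
    obtain ⟨s, t, hs, ht, hst, hp, hm⟩ := h2 (by rw [heq]; field_simp)
    simp only [smul_neg, ← sub_eq_add_neg, sub_neg_eq_add, map_neg, LinearMap.neg_apply,
      neg_neg] at hp hm hst
    rw [eq_inv_mul_iff_mul_eq₀ hk.ne'] at hm
    rw [eq_inv_mul_iff_mul_eq₀ hK.ne'] at hp
    exact ⟨s, t, hs, ht, (hb.sq_mul_eq_iff hg hh hk hm.symm).1 hst, hm.symm, hp.symm⟩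

theorem IsBoundedBy.isExtremalPair_of_eq {g h : V →ₗ[ℝ] V →ₗ[ℝ] ℝ} {k K : ℝ}
    (hg : IsInnerForm g) (hh : IsInnerForm h) (hk : 0 < k) (hK : 0 < K)
    (hb : IsBoundedBy g h k K) {u v : V} (huv : LinearIndependent ℝ ![u, v])
    (heq : sqTanHalf h u v = K / k * sqTanHalf g u v) : IsExtremalPair g h k K u v := by
  rcases le_or_gt 0 (h u v) with hC | hC
  · exact (hb.sqTanHalf_le_of_nonneg hg hh hk hK huv hC).2 heq
  rcases le_or_gt (g u v) 0 with hc | hc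
  · exact (hb.sqTanHalf_le_of_nonpos hg hh hk hK huv hc).2 heq
  -- Interpolate with a positive combination of `g` and `h` for which `u` and `v` are orthogonal.
  let f : V →ₗ[ℝ] V →ₗ[ℝ] ℝ := (-h u v) • g + g u v • h
  have f_apply (x y : V) : f x y = -h u v * g x y + g u v * h x y := by simp [f]
  have hC' : 0 < -h u v := neg_pos.2 hC
  have f_orth : f u v = 0 := by rw [f_apply]; ring
  have hf : IsInnerForm f :=
    ⟨fun x y => by rw [f_apply, f_apply, hg.symm x y, hh.symm x y],
      fun w hw => by
        have := hg.pos w hw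
        have := hh.pos w hw
        rw [f_apply]; positivity⟩
  generalize hC_def : -h u v = C at *
  generalize g u v = c at *
  have hgf : IsBoundedBy g f (C + c * k) (C + c * K) :=
    ⟨fun w => by rw [f_apply]; nlinarith [hb.lower w], fun w => by
      rw [f_apply]; nlinarith [hb.upper w]⟩
  have hk' : 0 < C + c * k := by positivity
  have hK' : 0 < C + c * K := by positivity
  have hfh : IsBoundedBy f h (k / (C + c * k)) (K / (C + c * K)) := by
    constructor
    · intro w
      rw [div_mul_eq_mul_div, div_le_iff₀ hk', f_apply]
      nlinarith [hb.lower w]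
    · intro w
      rw [div_mul_eq_mul_div, le_div_iff₀ hK', f_apply]
      nlinarith [hb.upper w]
  obtain ⟨h1, h1'⟩ := hgf.sqTanHalf_le_of_nonneg hg hf hk' hK' huv f_orth.ge
  have h2 := (hfh.sqTanHalf_le_of_nonpos hf hh (by positivity) (by positivity) huv f_orth.le).1
  have h3 : sqTanHalf f u v = (C + c * K) / (C + c * k) * sqTanHalf g u v := by
    refine le_antisymm h1 ?_
    refine le_of_mul_le_mul_left ?_
      (show 0 < K / (C + c * K) / (k / (C + c * k)) by positivity)
    refine le_trans (le_of_eq ?_) h2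
    rw [heq]
    field_simp
  obtain ⟨s, t, hs, ht, hst, hp, hm⟩ := h1' h3
  rw [f_apply] at hp hm
  refine ⟨s, t, hs, ht, hst, ?_, ?_⟩
  · exact mul_left_cancel₀ hc.ne' (by linear_combination hp)
  · exact mul_left_cancel₀ hc.ne' (by linear_combination hm)

theorem IsInnerForm.sqTanHalf_eq_div {g : V →ₗ[ℝ] V →ₗ[ℝ] ℝ} (hg : IsInnerForm g) (u v : V)
    {s t : ℝ} (hs : 0 < s) (ht : 0 < t) (hst : s ^ 2 * g u u = t ^ 2 * g v v) :
    sqTanHalf g u v = g (s • u - t • v) (s • u - t • v) / g (s • u + t • v) (s • u + t • v) := by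
  have e : s * √(g u u) = t * √(g v v) := by
    rw [← sq_eq_sq₀ (by positivity) (by positivity), mul_pow, mul_pow, hg.sq_sqrt, hg.sq_sqrt, hst]
  have e2 : s ^ 2 * g u u = s * t * (√(g u u) * √(g v v)) := by
    rw [← hg.sq_sqrt u]
    simp only [Real.sqrt_sq (Real.sqrt_nonneg _)]
    linear_combination s * √(g u u) * e
  rw [hg.add_self, hg.sub_self, ← hst, e2, sqTanHalf,
    ← mul_div_mul_left _ _ (show 2 * (s * t) ≠ 0 by positivity)]
  congr 1 <;> ring

theorem IsBoundedBy.sqTanHalf_eq {g h : V →ₗ[ℝ] V →ₗ[ℝ] ℝ} {k K : ℝ}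
    (hg : IsInnerForm g) (hh : IsInnerForm h) (hk : 0 < k)
    (hb : IsBoundedBy g h k K) {u v : V} (he : IsExtremalPair g h k K u v) :
    sqTanHalf h u v = K / k * sqTanHalf g u v := by
  obtain ⟨s, t, hs, ht, hst, hp, hm⟩ := he
  rw [hg.sqTanHalf_eq_div u v hs ht hst,
    hh.sqTanHalf_eq_div u v hs ht ((hb.sq_mul_eq_iff hg hh hk hp).2 hst), hp, hm,
    div_mul_div_comm]

theorem IsInnerForm.isExtremalPair_iff {g : V →ₗ[ℝ] V →ₗ[ℝ] ℝ} (hg : IsInnerForm g)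
    (h : V →ₗ[ℝ] V →ₗ[ℝ] ℝ) (k K : ℝ) {u v : V} (huv : LinearIndependent ℝ ![u, v]) :
    IsExtremalPair g h k K u v ↔
      h ((√(g u u))⁻¹ • u + (√(g v v))⁻¹ • v) ((√(g u u))⁻¹ • u + (√(g v v))⁻¹ • v) =
        k * g ((√(g u u))⁻¹ • u + (√(g v v))⁻¹ • v) ((√(g u u))⁻¹ • u + (√(g v v))⁻¹ • v) ∧
      h ((√(g u u))⁻¹ • u - (√(g v v))⁻¹ • v) ((√(g u u))⁻¹ • u - (√(g v v))⁻¹ • v) =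
        K * g ((√(g u u))⁻¹ • u - (√(g v v))⁻¹ • v) ((√(g u u))⁻¹ • u - (√(g v v))⁻¹ • v) := by
  obtain ⟨ha, hb⟩ := hg.sqrt_pos huv
  constructor
  · rintro ⟨s, t, hs, ht, hst, hp, hm⟩
    have e : s * √(g u u) = t * √(g v v) := by
      rw [← sq_eq_sq₀ (by positivity) (by positivity), mul_pow, mul_pow, hg.sq_sqrt, hg.sq_sqrt,
        hst]
    have es : s = s * √(g u u) * (√(g u u))⁻¹ := by field_simp
    have et : t = s * √(g u u) * (√(g v v))⁻¹ := by rw [e]; field_simp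
    have hr : s * √(g u u) ≠ 0 := by positivity
    generalize s * √(g u u) = r at *
    rw [es, et, mul_smul, mul_smul, ← smul_add] at hp
    rw [es, et, mul_smul, mul_smul, ← smul_sub] at hm
    simp only [map_smul, LinearMap.smul_apply, smul_eq_mul] at hp hm
    exact ⟨mul_left_cancel₀ (mul_ne_zero hr hr) (by linear_combination hp),
      mul_left_cancel₀ (mul_ne_zero hr hr) (by linear_combination hm)⟩
  · rintro ⟨hp, hm⟩
    refine ⟨_, _, inv_pos.2 ha, inv_pos.2 hb, ?_, hp, hm⟩
    rw [inv_pow, inv_pow, hg.sq_sqrt, hg.sq_sqrt,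
      inv_mul_cancel₀ (Real.sqrt_pos.1 ha).ne', inv_mul_cancel₀ (Real.sqrt_pos.1 hb).ne']

theorem IsInnerForm.sq_tan_half {g : V →ₗ[ℝ] V →ₗ[ℝ] ℝ} (hg : IsInnerForm g) {u v : V}
    (huv : LinearIndependent ℝ ![u, v]) {θ : ℝ}
    (hθ : Real.cos θ = g u v / (√(g u u) * √(g v v))) :
    Real.tan (θ / 2) ^ 2 = sqTanHalf g u v := by
  obtain ⟨ha, hb⟩ := hg.sqrt_pos huv
  have hp := (hg.strict_cauchy_schwarz huv).2
  have hab := mul_pos ha hb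
  have h1 : √(g u u) * √(g v v) - g u v = √(g u u) * √(g v v) * (1 - Real.cos θ) := by
    rw [hθ]; field_simp
  have h2 : √(g u u) * √(g v v) + g u v = √(g u u) * √(g v v) * (1 + Real.cos θ) := by
    rw [hθ]; field_simp
  have hc : Real.cos θ = 2 * Real.cos (θ / 2) ^ 2 - 1 := by
    rw [← Real.cos_two_mul]; ring_nf
  have hs := Real.sin_sq_add_cos_sq (θ / 2)
  rw [sqTanHalf, h1, h2, mul_div_mul_left _ _ hab.ne', Real.tan_eq_sin_div_cos, div_pow,
    show 1 - Real.cos θ = 2 * Real.sin (θ / 2) ^ 2 by linarith,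
    show 1 + Real.cos θ = 2 * Real.cos (θ / 2) ^ 2 by linarith,
    mul_div_mul_left _ _ two_ne_zero]

theorem tan_half_nonneg {θ : ℝ} (hθ : θ ∈ Set.Icc 0 Real.pi) : 0 ≤ Real.tan (θ / 2) :=
  Real.tan_nonneg_of_nonneg_of_le_pi_div_two (by linarith [hθ.1]) (by linarith [hθ.2])

theorem isBoundedBy_sq {g h : V →ₗ[ℝ] V →ₗ[ℝ] ℝ} (hg : IsInnerForm g) (hh : IsInnerForm h)
    {m M : ℝ} (hm : 0 ≤ m)
    (hl : ∀ w, w ≠ 0 → m ≤ √(h w w) / √(g w w)) (hu : ∀ w, w ≠ 0 → √(h w w) / √(g w w) ≤ M) :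
    IsBoundedBy g h (m ^ 2) (M ^ 2) := by
  constructor <;> intro w <;> rcases eq_or_ne w 0 with rfl | hw
  · simp
  · have h1 := hl w hw
    rw [le_div_iff₀ (Real.sqrt_pos.2 (hg.pos w hw))] at h1
    rw [← hg.sq_sqrt, ← hh.sq_sqrt, ← mul_pow]
    gcongr
  · simp
  · have h1 := hu w hw
    rw [div_le_iff₀ (Real.sqrt_pos.2 (hg.pos w hw))] at h1
    rw [← hg.sq_sqrt, ← hh.sq_sqrt, ← mul_pow]
    gcongr

theorem IsInnerForm.sqrt_eq_mul_sqrt_iff {g h : V →ₗ[ℝ] V →ₗ[ℝ] ℝ} (hg : IsInnerForm g)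
    (hh : IsInnerForm h) {r : ℝ} (hr : 0 ≤ r) (w : V) :
    √(h w w) = r * √(g w w) ↔ h w w = r ^ 2 * g w w := by
  rw [← sq_eq_sq₀ (by positivity) (by positivity), mul_pow, hg.sq_sqrt, hh.sq_sqrt]

end HalfAngle

/-- Theorem 2.4, equality case for the right-hand inequality:
`tan(ψ/2) = (M/m)·tan(φ/2)` if and only if `(u, v) ∈ E`. -/
theorem tan_half_angle_right_equality_iff
    {V : Type*} [AddCommGroup V] [Module ℝ V]
    (ip1 ip2 : V →ₗ[ℝ] V →ₗ[ℝ] ℝ)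
    (symm1 : ∀ u v : V, ip1 u v = ip1 v u)
    (symm2 : ∀ u v : V, ip2 u v = ip2 v u)
    (pos1 : ∀ v : V, v ≠ 0 → 0 < ip1 v v)
    (pos2 : ∀ v : V, v ≠ 0 → 0 < ip2 v v)
    (m M : ℝ) (hm0 : 0 < m)
    (hm : IsGLB {r : ℝ | ∃ v : V, v ≠ 0 ∧ r = Real.sqrt (ip2 v v) / Real.sqrt (ip1 v v)} m)
    (hM : IsLUB {r : ℝ | ∃ v : V, v ≠ 0 ∧ r = Real.sqrt (ip2 v v) / Real.sqrt (ip1 v v)} M)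
    (u v : V) (huv : LinearIndependent ℝ ![u, v])
    (φ ψ : ℝ) (hφ : φ ∈ Set.Icc 0 Real.pi) (hψ : ψ ∈ Set.Icc 0 Real.pi)
    (hcosφ : Real.cos φ = ip1 u v / (Real.sqrt (ip1 u u) * Real.sqrt (ip1 v v)))
    (hcosψ : Real.cos ψ = ip2 u v / (Real.sqrt (ip2 u u) * Real.sqrt (ip2 v v))) :
    Real.tan (ψ / 2) = M / m * Real.tan (φ / 2) ↔
      (u ≠ 0 ∧ v ≠ 0 ∧
        ((Real.sqrt (ip1 u u))⁻¹ • u + (Real.sqrt (ip1 v v))⁻¹ • v ∈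
          {w : V | Real.sqrt (ip2 w w) = m * Real.sqrt (ip1 w w)}) ∧
        ((Real.sqrt (ip1 u u))⁻¹ • u - (Real.sqrt (ip1 v v))⁻¹ • v ∈
          {w : V | Real.sqrt (ip2 w w) = M * Real.sqrt (ip1 w w)})) := by
  have hg : IsInnerForm ip1 := ⟨symm1, pos1⟩
  have hh : IsInnerForm ip2 := ⟨symm2, pos2⟩
  have hu : u ≠ 0 := by simpa using huv.ne_zero 0
  have hv : v ≠ 0 := by simpa using huv.ne_zero 1
  have hM0 : 0 < M := hm0.trans_le ((hm.1 ⟨u, hu, rfl⟩).trans (hM.1 ⟨u, hu, rfl⟩))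
  have hb := isBoundedBy_sq hg hh hm0.le (fun w hw => hm.1 ⟨w, hw, rfl⟩)
    (fun w hw => hM.1 ⟨w, hw, rfl⟩)
  have hφ' := tan_half_nonneg hφ
  have hψ' := tan_half_nonneg hψ
  rw [Set.mem_ofPred_eq, Set.mem_ofPred_eq, hg.sqrt_eq_mul_sqrt_iff hh hm0.le,
    hg.sqrt_eq_mul_sqrt_iff hh hM0.le, ← hg.isExtremalPair_iff ip2 _ _ huv,
    ← sq_eq_sq₀ hψ' (by positivity), mul_pow, hh.sq_tan_half huv hcosψ,
    hg.sq_tan_half huv hcosφ, div_pow]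
  exact ⟨fun h => ⟨hu, hv, hb.isExtremalPair_of_eq hg hh (by positivity) (by positivity) huv h⟩,
    fun h => hb.sqTanHalf_eq hg hh (by positivity) h.2.2⟩
end

section
/- Let S and T be subsets of V, each containing at least one non-zero vector. Let Φ, Ψ ∈ [0,π] be the angles between S and T with respect to the two inner products, i.e., cos Φ = sup{⟨u,v⟩₁/(‖u‖₁‖v‖₁) : 0 ≠ u ∈ S, 0 ≠ v ∈ T} and cos Ψ = sup{⟨u,v⟩₂/(‖u‖₂‖v‖₂) : 0 ≠ u ∈ S, 0 ≠ v ∈ T}. Then (m/M)·tan(Φ/2) ≤ tan(Ψ/2) ≤ (M/m)·tan(Φ/2). -/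
section TwoInnerProducts

variable {V : Type*} [AddCommGroup V] [Module ℝ V]

theorem inner_self_nonneg_of_pos {ip : V →ₗ[ℝ] V →ₗ[ℝ] ℝ}
    (pos : ∀ v : V, v ≠ 0 → 0 < ip v v) (v : V) : 0 ≤ ip v v := by
  rcases eq_or_ne v 0 with rfl | hv
  · simp
  · exact (pos v hv).le

theorem inner_add_smul_self {ip : V →ₗ[ℝ] V →ₗ[ℝ] ℝ} (symm : ∀ u v : V, ip u v = ip v u)
    (s t : ℝ) (u v : V) :
    ip (s • u + t • v) (s • u + t • v) = s ^ 2 * ip u u + 2 * s * t * ip u v + t ^ 2 * ip v v := by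
  simp only [map_add, map_smul, LinearMap.add_apply, LinearMap.smul_apply, smul_eq_mul, symm v u]
  ring

theorem cos_le_one_of_pos {ip : V →ₗ[ℝ] V →ₗ[ℝ] ℝ} (symm : ∀ u v : V, ip u v = ip v u)
    (pos : ∀ v : V, v ≠ 0 → 0 < ip v v) {u v : V} (hu : u ≠ 0) (hv : v ≠ 0) :
    ip u v / (Real.sqrt (ip u u) * Real.sqrt (ip v v)) ≤ 1 := by
  have hp := Real.sqrt_pos.2 (pos u hu)
  have hq := Real.sqrt_pos.2 (pos v hv)
  have hp2 := Real.sq_sqrt (pos u hu).le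
  have hq2 := Real.sq_sqrt (pos v hv).le
  set p := Real.sqrt (ip u u)
  set q := Real.sqrt (ip v v)
  have hpq : 0 < p * q := mul_pos hp hq
  rw [div_le_one hpq]
  have h := inner_self_nonneg_of_pos pos (q • u + (-p) • v)
  rw [inner_add_smul_self symm, ← hp2, ← hq2] at h
  have h' : 0 ≤ (p * q) * (p * q - ip u v) := by linarith
  linarith [nonneg_of_mul_nonneg_right h' hpq]

/-- If `w` and `d` are orthogonal for `ip1`, their Gram determinant for `ip2` is bounded below. -/
theorem gram_lower_bound {ip1 ip2 : V →ₗ[ℝ] V →ₗ[ℝ] ℝ}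
    (symm1 : ∀ u v : V, ip1 u v = ip1 v u) (symm2 : ∀ u v : V, ip2 u v = ip2 v u)
    (pos1 : ∀ v : V, v ≠ 0 → 0 < ip1 v v) (pos2 : ∀ v : V, v ≠ 0 → 0 < ip2 v v)
    {n N : ℝ} (hn : 0 < n) (hlow : ∀ v, n * ip1 v v ≤ ip2 v v)
    (hupp : ∀ v, ip2 v v ≤ N * ip1 v v) {w d : V} (hwd : ip1 w d = 0) :
    n * ip2 d d ^ 2 * ip1 w w ≤ N * ip1 d d * (ip2 w w * ip2 d d - ip2 w d ^ 2) := by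
  rcases eq_or_ne d 0 with rfl | hd
  · simp
  have hD := pos2 d hd
  have h := hlow (ip2 d d • w + (-ip2 w d) • d)
  rw [inner_add_smul_self symm1, inner_add_smul_self symm2, hwd] at h
  have hd1 := inner_self_nonneg_of_pos pos1 d
  have hw1 := inner_self_nonneg_of_pos pos1 w
  have hgram : n * ip2 d d * ip1 w w ≤ ip2 w w * ip2 d d - ip2 w d ^ 2 := by
    refine le_of_mul_le_mul_left ?_ hD
    have := mul_nonneg hn.le (mul_nonneg (sq_nonneg (ip2 w d)) hd1)
    linarith
  have hnonneg : 0 ≤ n * ip2 d d * ip1 w w := by positivity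
  calc n * ip2 d d ^ 2 * ip1 w w = ip2 d d * (n * ip2 d d * ip1 w w) := by ring
    _ ≤ (N * ip1 d d) * (n * ip2 d d * ip1 w w) :=
        mul_le_mul_of_nonneg_right (hupp d) hnonneg
    _ ≤ _ := mul_le_mul_of_nonneg_left hgram (hD.le.trans (hupp d))

theorem cos_comparison {ip1 ip2 : V →ₗ[ℝ] V →ₗ[ℝ] ℝ}
    (symm1 : ∀ u v : V, ip1 u v = ip1 v u) (symm2 : ∀ u v : V, ip2 u v = ip2 v u)
    (pos1 : ∀ v : V, v ≠ 0 → 0 < ip1 v v) (pos2 : ∀ v : V, v ≠ 0 → 0 < ip2 v v)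
    {n N : ℝ} (hn : 0 < n) (hN : 0 < N) (hlow : ∀ v, n * ip1 v v ≤ ip2 v v)
    (hupp : ∀ v, ip2 v v ≤ N * ip1 v v) {u v : V} (hu : u ≠ 0) (hv : v ≠ 0) :
    n * (1 - ip2 u v / (Real.sqrt (ip2 u u) * Real.sqrt (ip2 v v))) *
        (1 + ip1 u v / (Real.sqrt (ip1 u u) * Real.sqrt (ip1 v v))) ≤
      N * (1 + ip2 u v / (Real.sqrt (ip2 u u) * Real.sqrt (ip2 v v))) *
        (1 - ip1 u v / (Real.sqrt (ip1 u u) * Real.sqrt (ip1 v v))) := by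
  have hb := cos_le_one_of_pos symm2 pos2 hu hv
  have ha := cos_le_one_of_pos symm1 pos1 hu hv
  have hb' := cos_le_one_of_pos symm2 pos2 hu (neg_ne_zero.2 hv)
  simp only [map_neg, LinearMap.neg_apply, neg_neg, neg_div] at hb'
  have hr := Real.sqrt_pos.2 (pos1 u hu)
  have hs := Real.sqrt_pos.2 (pos1 v hv)
  have hp := Real.sqrt_pos.2 (pos2 u hu)
  have hq := Real.sqrt_pos.2 (pos2 v hv)
  have hr2 := Real.sq_sqrt (pos1 u hu).le
  have hs2 := Real.sq_sqrt (pos1 v hv).le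
  have hp2 := Real.sq_sqrt (pos2 u hu).le
  have hq2 := Real.sq_sqrt (pos2 v hv).le
  set r := Real.sqrt (ip1 u u)
  set s := Real.sqrt (ip1 v v)
  set p := Real.sqrt (ip2 u u)
  set q := Real.sqrt (ip2 v v)
  obtain ⟨a, ha_def⟩ : ∃ a, a = ip1 u v / (r * s) := ⟨_, rfl⟩
  obtain ⟨b, hb_def⟩ : ∃ b, b = ip2 u v / (p * q) := ⟨_, rfl⟩
  rw [← ha_def] at ha ⊢
  rw [← hb_def] at hb hb' ⊢
  have hau : ip1 u v = a * (r * s) := by rw [ha_def]; field_simp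
  have hbu : ip2 u v = b * (p * q) := by rw [hb_def]; field_simp
  have hrhs : 0 ≤ N * (1 + b) * (1 - a) :=
    mul_nonneg (mul_nonneg hN.le (by linarith)) (by linarith)
  rcases hb.eq_or_lt with rfl | hb1
  · simpa using hrhs
  have cross : ∀ ip : V →ₗ[ℝ] V →ₗ[ℝ] ℝ, (∀ u v : V, ip u v = ip v u) →
      ip (s • u + r • v) (s • u + (-r) • v) = s ^ 2 * ip u u - r ^ 2 * ip v v := by
    intro ip symm
    simp only [map_add, map_smul, LinearMap.add_apply, LinearMap.smul_apply, smul_eq_mul, symm v u]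
    ring
  have hwd : ip1 (s • u + r • v) (s • u + (-r) • v) = 0 := by
    rw [cross ip1 symm1, ← hr2, ← hs2]; ring
  have key := gram_lower_bound symm1 symm2 pos1 pos2 hn hlow hupp hwd
  rw [cross ip2 symm2] at key
  simp only [inner_add_smul_self symm1, inner_add_smul_self symm2] at key
  rw [hau, hbu, ← hr2, ← hs2, ← hp2, ← hq2] at key
  have hk : 0 < r * s := mul_pos hr hs
  have hl : 0 < r * s * (p * q) := mul_pos hk (mul_pos hp hq)
  by_cases ha1 : 0 ≤ 1 + a
  swap
  · have : n * (1 - b) * (1 + a) ≤ 0 :=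
      mul_nonpos_of_nonneg_of_nonpos (mul_nonneg hn.le (by linarith)) (by linarith)
    linarith
  have hdist : 2 * (r * s * (p * q)) * (1 - b) ≤
      s ^ 2 * p ^ 2 + 2 * s * (-r) * (b * (p * q)) + (-r) ^ 2 * q ^ 2 := by
    linarith [sq_nonneg (s * p - r * q)]
  have hsq := pow_le_pow_left₀ (by nlinarith) hdist 2
  have hfac : 0 ≤ n * (2 * (r * s) ^ 2 * (1 + a)) := by positivity
  have hmul := mul_le_mul_of_nonneg_right hsq hfac
  have hpos : 0 < 8 * (r * s) ^ 2 * (r * s * (p * q)) ^ 2 * (1 - b) := by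
    have : 0 < 1 - b := by linarith
    positivity
  refine le_of_mul_le_mul_left ?_ hpos
  linarith

theorem cos_sSup_comparison {ip1 ip2 : V →ₗ[ℝ] V →ₗ[ℝ] ℝ}
    (symm1 : ∀ u v : V, ip1 u v = ip1 v u) (symm2 : ∀ u v : V, ip2 u v = ip2 v u)
    (pos1 : ∀ v : V, v ≠ 0 → 0 < ip1 v v) (pos2 : ∀ v : V, v ≠ 0 → 0 < ip2 v v)
    {n N : ℝ} (hn : 0 < n) (hN : 0 < N) (hlow : ∀ v, n * ip1 v v ≤ ip2 v v)
    (hupp : ∀ v, ip2 v v ≤ N * ip1 v v)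
    {S T : Set V} (hS : ∃ u ∈ S, u ≠ 0) (hT : ∃ v ∈ T, v ≠ 0) {Φ Ψ : ℝ}
    (hcosΦ : Real.cos Φ = sSup {r : ℝ | ∃ u ∈ S, ∃ v ∈ T, u ≠ 0 ∧ v ≠ 0 ∧
        r = ip1 u v / (Real.sqrt (ip1 u u) * Real.sqrt (ip1 v v))})
    (hcosΨ : Real.cos Ψ = sSup {r : ℝ | ∃ u ∈ S, ∃ v ∈ T, u ≠ 0 ∧ v ≠ 0 ∧
        r = ip2 u v / (Real.sqrt (ip2 u u) * Real.sqrt (ip2 v v))}) :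
    n * (1 - Real.cos Ψ) * (1 + Real.cos Φ) ≤ N * (1 + Real.cos Ψ) * (1 - Real.cos Φ) := by
  have h1 := Real.cos_le_one Ψ
  have h2 := Real.neg_one_le_cos Ψ
  have hcoef : 0 < n * (1 - Real.cos Ψ) + N * (1 + Real.cos Ψ) := by
    rcases h1.eq_or_lt with h | h
    · rw [h]; linarith
    · have := mul_pos hn (sub_pos.2 h)
      have := mul_nonneg hN.le (by linarith : 0 ≤ 1 + Real.cos Ψ)
      linarith
  have hle : Real.cos Φ ≤ (N * (1 + Real.cos Ψ) - n * (1 - Real.cos Ψ)) /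
      (n * (1 - Real.cos Ψ) + N * (1 + Real.cos Ψ)) := by
    rw [hcosΦ]
    obtain ⟨u₀, hu₀, hu₀'⟩ := hS
    obtain ⟨v₀, hv₀, hv₀'⟩ := hT
    refine csSup_le ⟨_, u₀, hu₀, v₀, hv₀, hu₀', hv₀', rfl⟩ ?_
    rintro _ ⟨u, hu, v, hv, hu', hv', rfl⟩
    have hb : ip2 u v / (Real.sqrt (ip2 u u) * Real.sqrt (ip2 v v)) ≤ Real.cos Ψ := by
      rw [hcosΨ]
      refine le_csSup ⟨1, ?_⟩ ⟨u, hu, v, hv, hu', hv', rfl⟩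
      rintro _ ⟨x, -, y, -, hx, hy, rfl⟩
      exact cos_le_one_of_pos symm2 pos2 hx hy
    have hpair := cos_comparison symm1 symm2 pos1 pos2 hn hN hlow hupp hu' hv'
    have ha := cos_le_one_of_pos symm1 pos1 hu' hv'
    have ha' := cos_le_one_of_pos symm1 pos1 hu' (neg_ne_zero.2 hv')
    simp only [map_neg, LinearMap.neg_apply, neg_neg, neg_div] at ha'
    set a := ip1 u v / (Real.sqrt (ip1 u u) * Real.sqrt (ip1 v v))
    set b := ip2 u v / (Real.sqrt (ip2 u u) * Real.sqrt (ip2 v v))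
    rw [le_div_iff₀ hcoef]
    have e1 := mul_nonneg (mul_nonneg hn.le (sub_nonneg.2 hb)) (by linarith : 0 ≤ 1 + a)
    have e2 := mul_nonneg (mul_nonneg hN.le (sub_nonneg.2 hb)) (sub_nonneg.2 ha)
    linarith
  rw [le_div_iff₀ hcoef] at hle
  linarith

end TwoInnerProducts

theorem mul_sin_half_mul_cos_half_le {m M Φ Ψ : ℝ} (hM : 0 ≤ M)
    (hΦ : Φ ∈ Set.Icc 0 Real.pi) (hΨ : Ψ ∈ Set.Icc 0 Real.pi)
    (h : m ^ 2 * (1 - Real.cos Ψ) * (1 + Real.cos Φ) ≤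
      M ^ 2 * (1 + Real.cos Ψ) * (1 - Real.cos Φ)) :
    m * Real.sin (Ψ / 2) * Real.cos (Φ / 2) ≤ M * Real.cos (Ψ / 2) * Real.sin (Φ / 2) := by
  have hs : 0 ≤ Real.sin (Φ / 2) :=
    Real.sin_nonneg_of_nonneg_of_le_pi (by linarith [hΦ.1]) (by linarith [hΦ.1, hΦ.2])
  have hc : 0 ≤ Real.cos (Ψ / 2) :=
    Real.cos_nonneg_of_neg_pi_div_two_le_of_le (by linarith [hΨ.1, Real.pi_pos])
      (by linarith [hΨ.2])
  have half : ∀ x : ℝ, 1 - Real.cos x = 2 * Real.sin (x / 2) ^ 2 ∧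
      1 + Real.cos x = 2 * Real.cos (x / 2) ^ 2 := fun x => by
    have h1 := Real.cos_sq (x / 2)
    have h2 := Real.sin_sq_add_cos_sq (x / 2)
    rw [mul_div_cancel₀ x two_ne_zero] at h1
    constructor <;> linarith
  rw [(half Φ).1, (half Φ).2, (half Ψ).1, (half Ψ).2] at h
  refine le_of_abs_le (abs_le_of_sq_le_sq ?_ (by positivity))
  linarith


/-- Corollary 2.5: the half-angle tangent bounds hold for the angles between
two subsets `S` and `T` of `V`, each containing a non-zero vector. -/
theorem tan_half_angle_bounds_sets
    {V : Type*} [AddCommGroup V] [Module ℝ V]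
    (ip1 ip2 : V →ₗ[ℝ] V →ₗ[ℝ] ℝ)
    (symm1 : ∀ u v : V, ip1 u v = ip1 v u)
    (symm2 : ∀ u v : V, ip2 u v = ip2 v u)
    (pos1 : ∀ v : V, v ≠ 0 → 0 < ip1 v v)
    (pos2 : ∀ v : V, v ≠ 0 → 0 < ip2 v v)
    (m M : ℝ) (hm0 : 0 < m)
    (hm : IsGLB {r : ℝ | ∃ v : V, v ≠ 0 ∧ r = Real.sqrt (ip2 v v) / Real.sqrt (ip1 v v)} m)
    (hM : IsLUB {r : ℝ | ∃ v : V, v ≠ 0 ∧ r = Real.sqrt (ip2 v v) / Real.sqrt (ip1 v v)} M)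
    (S T : Set V) (hS : ∃ u ∈ S, u ≠ 0) (hT : ∃ v ∈ T, v ≠ 0)
    (Φ Ψ : ℝ) (hΦ : Φ ∈ Set.Icc 0 Real.pi) (hΨ : Ψ ∈ Set.Icc 0 Real.pi)
    (hcosΦ : Real.cos Φ = sSup {r : ℝ | ∃ u ∈ S, ∃ v ∈ T, u ≠ 0 ∧ v ≠ 0 ∧
        r = ip1 u v / (Real.sqrt (ip1 u u) * Real.sqrt (ip1 v v))})
    (hcosΨ : Real.cos Ψ = sSup {r : ℝ | ∃ u ∈ S, ∃ v ∈ T, u ≠ 0 ∧ v ≠ 0 ∧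
        r = ip2 u v / (Real.sqrt (ip2 u u) * Real.sqrt (ip2 v v))}) :
    m / M * Real.tan (Φ / 2) ≤ Real.tan (Ψ / 2) ∧
    Real.tan (Ψ / 2) ≤ M / m * Real.tan (Φ / 2) := by
  have ⟨u₀, _, hu₀⟩ := hS
  have hratio : ∀ v : V, v ≠ 0 → m * Real.sqrt (ip1 v v) ≤ Real.sqrt (ip2 v v) ∧
      Real.sqrt (ip2 v v) ≤ M * Real.sqrt (ip1 v v) := fun v hv => by
    have hv1 := Real.sqrt_pos.2 (pos1 v hv)
    exact ⟨(le_div_iff₀ hv1).1 (hm.1 ⟨v, hv, rfl⟩), (div_le_iff₀ hv1).1 (hM.1 ⟨v, hv, rfl⟩)⟩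
  have hM0 : 0 < M :=
    hm0.trans_le ((hm.1 ⟨u₀, hu₀, rfl⟩).trans (hM.1 ⟨u₀, hu₀, rfl⟩))
  have hlow : ∀ v, m ^ 2 * ip1 v v ≤ ip2 v v := fun v => by
    rcases eq_or_ne v 0 with rfl | hv
    · simp
    rw [← Real.sq_sqrt (pos1 v hv).le, ← Real.sq_sqrt (pos2 v hv).le, ← mul_pow]
    exact pow_le_pow_left₀ (by positivity) (hratio v hv).1 2
  have hupp : ∀ v, ip2 v v ≤ M ^ 2 * ip1 v v := fun v => by
    rcases eq_or_ne v 0 with rfl | hv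
    · simp
    rw [← Real.sq_sqrt (pos1 v hv).le, ← Real.sq_sqrt (pos2 v hv).le, ← mul_pow]
    exact pow_le_pow_left₀ (by positivity) (hratio v hv).2 2
  have hm2 : 0 < m ^ 2 := by positivity
  have hM2 : 0 < M ^ 2 := by positivity
  have hΨΦ := mul_sin_half_mul_cos_half_le hM0.le hΦ hΨ <|
    cos_sSup_comparison symm1 symm2 pos1 pos2 hm2 hM2 hlow hupp hS hT hcosΦ hcosΨ
  have hswap := cos_sSup_comparison symm2 symm1 pos2 pos1 (inv_pos.2 hM2) (inv_pos.2 hm2)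
    (fun v => (inv_mul_le_iff₀ hM2).2 (hupp v)) (fun v => (le_inv_mul_iff₀ hm2).2 (hlow v))
    hS hT hcosΨ hcosΦ
  have hΦΨ := mul_sin_half_mul_cos_half_le (m := m) hM0.le hΨ hΦ <| by
    have := mul_le_mul_of_nonneg_left hswap (mul_pos hm2 hM2).le
    field_simp at this
    linarith
  have hcos : ∀ x ∈ Set.Icc 0 Real.pi, 0 ≤ Real.cos (x / 2) := fun x hx =>
    Real.cos_nonneg_of_neg_pi_div_two_le_of_le (by linarith [hx.1, Real.pi_pos])
      (by linarith [hx.2])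
  have hsin : ∀ x ∈ Set.Icc 0 Real.pi, Real.cos (x / 2) = 0 → Real.sin (x / 2) = 1 := by
    intro x hx h
    have h0 := Real.sin_nonneg_of_nonneg_of_le_pi (x := x / 2) (by linarith [hx.1])
      (by linarith [hx.1, hx.2])
    have h1 := Real.sin_sq_add_cos_sq (x / 2)
    rw [h] at h1
    nlinarith
  have hiff : Real.cos (Φ / 2) = 0 ↔ Real.cos (Ψ / 2) = 0 := by
    constructor <;> intro h
    · rw [hsin Φ hΦ h, h] at hΦΨ
      nlinarith [hcos Ψ hΨ]
    · rw [hsin Ψ hΨ h, h] at hΨΦ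
      nlinarith [hcos Φ hΦ]
  simp only [Real.tan_eq_sin_div_cos]
  by_cases h : Real.cos (Φ / 2) = 0
  · simp [h, hiff.1 h]
  have hcΦ := (hcos Φ hΦ).lt_of_ne' h
  have hcΨ := (hcos Ψ hΨ).lt_of_ne' fun h' => h (hiff.2 h')
  constructor <;> rw [div_mul_div_comm, div_le_div_iff₀ (by positivity) (by positivity)] <;> linarith
end

section
/- For linearly independent vectors u and v in V, let Φ, Ψ ∈ [0,π/2] be defined by cos Φ = |⟨u,v⟩₁|/(‖u‖₁‖v‖₁) and cos Ψ = |⟨u,v⟩₂|/(‖u‖₂‖v‖₂). Then (m/M)·tan(Φ/2) ≤ tan(Ψ/2) ≤ (M/m)·tan(Φ/2). -/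
theorem mul_tan_half_le_mul_tan_half {k K φ ψ : ℝ} (hK : 0 ≤ K)
    (hφ : φ ∈ Set.Icc 0 (Real.pi / 2)) (hψ : ψ ∈ Set.Icc 0 (Real.pi / 2))
    (h : k ^ 2 * ((1 - Real.cos ψ) * (1 + Real.cos φ)) ≤
      K ^ 2 * ((1 - Real.cos φ) * (1 + Real.cos ψ))) :
    k * Real.tan (ψ / 2) ≤ K * Real.tan (φ / 2) := by
  have hpi := Real.pi_pos
  obtain ⟨hφ0, hφ1⟩ := hφ
  obtain ⟨hψ0, hψ1⟩ := hψ
  have hcφ : 0 < Real.cos (φ / 2) := Real.cos_pos_of_mem_Ioo ⟨by linarith, by linarith⟩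
  have hcψ : 0 < Real.cos (ψ / 2) := Real.cos_pos_of_mem_Ioo ⟨by linarith, by linarith⟩
  have hsφ : 0 ≤ Real.sin (φ / 2) := Real.sin_nonneg_of_nonneg_of_le_pi (by linarith) (by linarith)
  have add_cos (θ : ℝ) : 1 + Real.cos θ = 2 * Real.cos (θ / 2) ^ 2 := by
    rw [Real.cos_sq, mul_div_cancel₀ θ two_ne_zero]; ring
  have sub_cos (θ : ℝ) : 1 - Real.cos θ = 2 * Real.sin (θ / 2) ^ 2 := by
    rw [Real.sin_sq, Real.cos_sq, mul_div_cancel₀ θ two_ne_zero]; ring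
  rw [add_cos, add_cos, sub_cos, sub_cos] at h
  have key : k * Real.sin (ψ / 2) * Real.cos (φ / 2) ≤
      K * Real.sin (φ / 2) * Real.cos (ψ / 2) :=
    le_of_sq_le_sq (by linarith) (by positivity)
  rw [Real.tan_eq_sin_div_cos, Real.tan_eq_sin_div_cos, ← mul_div_assoc, ← mul_div_assoc,
    div_le_div_iff₀ hcψ hcφ]
  exact key

/-- The generalized Wielandt inequality in terms of the cosines of the angles between two lines. -/
theorem wielandt_cos_le {V : Type*} [AddCommGroup V] [Module ℝ V]
    (ip1 ip2 : V →ₗ[ℝ] V →ₗ[ℝ] ℝ)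
    (symm1 : ∀ u v : V, ip1 u v = ip1 v u)
    (symm2 : ∀ u v : V, ip2 u v = ip2 v u)
    (pos1 : ∀ v : V, v ≠ 0 → 0 < ip1 v v)
    (pos2 : ∀ v : V, v ≠ 0 → 0 < ip2 v v)
    {a b : ℝ} (ha : ∀ v, a * ip1 v v ≤ ip2 v v) (hb : ∀ v, ip2 v v ≤ b * ip1 v v)
    {u v : V} (hu : u ≠ 0) (hv : v ≠ 0) {c d : ℝ} (hd0 : 0 ≤ d) (hd1 : d ≤ 1)
    (hc : c = |ip1 u v| / (Real.sqrt (ip1 u u) * Real.sqrt (ip1 v v)))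
    (hd : d = |ip2 u v| / (Real.sqrt (ip2 u u) * Real.sqrt (ip2 v v))) :
    a * ((1 - d) * (1 + c)) ≤ b * ((1 - c) * (1 + d)) := by
  have hp : 0 < √(ip1 u u) := Real.sqrt_pos.2 (pos1 u hu)
  have hq : 0 < √(ip1 v v) := Real.sqrt_pos.2 (pos1 v hv)
  have hr : 0 < √(ip2 u u) := Real.sqrt_pos.2 (pos2 u hu)
  have hs : 0 < √(ip2 v v) := Real.sqrt_pos.2 (pos2 v hv)
  have hp2 := Real.sq_sqrt (pos1 u hu).le
  have hq2 := Real.sq_sqrt (pos1 v hv).le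
  have hr2 := Real.sq_sqrt (pos2 u hu).le
  have hs2 := Real.sq_sqrt (pos2 v hv).le
  rw [eq_div_iff (by positivity)] at hc hd
  set p := √(ip1 u u)
  set q := √(ip1 v v)
  set r := √(ip2 u u)
  set s := √(ip2 v v)
  obtain ⟨σ, hσ, hσc⟩ : ∃ σ : ℝ, |σ| = 1 ∧ σ * ip1 u v = |ip1 u v| := by
    rcases abs_choice (ip1 u v) with h | h
    · exact ⟨1, by simp, by rw [h, one_mul]⟩
    · exact ⟨-1, by simp, by rw [h, neg_one_mul]⟩
  have hσ2 : σ ^ 2 = 1 := by rw [← sq_abs, hσ, one_pow]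
  have hσd : σ * ip2 u v ≤ d * (r * s) := by
    rw [hd]
    calc σ * ip2 u v ≤ |σ * ip2 u v| := le_abs_self _
      _ = |ip2 u v| := by rw [abs_mul, hσ, one_mul]
  -- `q • u` and `(σ * p) • v` have equal first norms and nonnegative first inner product.
  have add1 : ip1 (q • u + (σ * p) • v) (q • u + (σ * p) • v) = 2 * (p * q) ^ 2 * (1 + c) := by
    simp only [map_add, map_smul, LinearMap.add_apply, LinearMap.smul_apply, smul_eq_mul,
      symm1 v u]
    linear_combination (-q ^ 2) * hp2 - σ ^ 2 * p ^ 2 * hq2 + 2 * p * q * hσc - 2 * p * q * hc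
      + p ^ 2 * q ^ 2 * hσ2
  have sub1 : ip1 (q • u - (σ * p) • v) (q • u - (σ * p) • v) = 2 * (p * q) ^ 2 * (1 - c) := by
    simp only [map_sub, map_smul, LinearMap.sub_apply, LinearMap.smul_apply, smul_eq_mul,
      symm1 v u]
    linear_combination (-q ^ 2) * hp2 - σ ^ 2 * p ^ 2 * hq2 - 2 * p * q * hσc + 2 * p * q * hc
      + p ^ 2 * q ^ 2 * hσ2
  have add2 : ip2 (q • u + (σ * p) • v) (q • u + (σ * p) • v) =
      (q * r) ^ 2 + (p * s) ^ 2 + 2 * (p * q) * (σ * ip2 u v) := by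
    simp only [map_add, map_smul, LinearMap.add_apply, LinearMap.smul_apply, smul_eq_mul,
      symm2 v u]
    linear_combination (-q ^ 2) * hr2 - σ ^ 2 * p ^ 2 * hs2 + p ^ 2 * s ^ 2 * hσ2
  have sub2 : ip2 (q • u - (σ * p) • v) (q • u - (σ * p) • v) =
      (q * r) ^ 2 + (p * s) ^ 2 - 2 * (p * q) * (σ * ip2 u v) := by
    simp only [map_sub, map_smul, LinearMap.sub_apply, LinearMap.smul_apply, smul_eq_mul,
      symm2 v u]
    linear_combination (-q ^ 2) * hr2 - σ ^ 2 * p ^ 2 * hs2 + p ^ 2 * s ^ 2 * hσ2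
  have hlow := ha (q • u + (σ * p) • v)
  have hupp := hb (q • u - (σ * p) • v)
  rw [add1, add2] at hlow
  rw [sub1, sub2] at hupp
  have hpq : 0 < p * q := by positivity
  have hmid : (1 - d) * ((q * r) ^ 2 + (p * s) ^ 2 + 2 * (p * q) * (σ * ip2 u v)) ≤
      (1 + d) * ((q * r) ^ 2 + (p * s) ^ 2 - 2 * (p * q) * (σ * ip2 u v)) := by
    linear_combination 4 * (p * q) * hσd + 2 * d * sq_nonneg (q * r - p * s)
  have h1 := mul_le_mul_of_nonneg_left hlow (sub_nonneg.2 hd1)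
  have h2 := mul_le_mul_of_nonneg_left hupp (by linarith : 0 ≤ 1 + d)
  refine le_of_mul_le_mul_left ?_ (by positivity : 0 < 2 * (p * q) ^ 2)
  linarith


/-- Theorem 2.6 (generalized Wielandt inequality in inner product spaces):
for the angles `Φ, Ψ ∈ [0, π/2]` between the lines determined by independent
vectors `u, v`, `(m/M)·tan(Φ/2) ≤ tan(Ψ/2) ≤ (M/m)·tan(Φ/2)`. -/
theorem tan_half_angle_bounds_lines
    {V : Type*} [AddCommGroup V] [Module ℝ V]
    (ip1 ip2 : V →ₗ[ℝ] V →ₗ[ℝ] ℝ)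
    (symm1 : ∀ u v : V, ip1 u v = ip1 v u)
    (symm2 : ∀ u v : V, ip2 u v = ip2 v u)
    (pos1 : ∀ v : V, v ≠ 0 → 0 < ip1 v v)
    (pos2 : ∀ v : V, v ≠ 0 → 0 < ip2 v v)
    (m M : ℝ) (hm0 : 0 < m)
    (hm : IsGLB {r : ℝ | ∃ v : V, v ≠ 0 ∧ r = Real.sqrt (ip2 v v) / Real.sqrt (ip1 v v)} m)
    (hM : IsLUB {r : ℝ | ∃ v : V, v ≠ 0 ∧ r = Real.sqrt (ip2 v v) / Real.sqrt (ip1 v v)} M)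
    (u v : V) (huv : LinearIndependent ℝ ![u, v])
    (Φ Ψ : ℝ) (hΦ : Φ ∈ Set.Icc 0 (Real.pi / 2)) (hΨ : Ψ ∈ Set.Icc 0 (Real.pi / 2))
    (hcosΦ : Real.cos Φ = |ip1 u v| / (Real.sqrt (ip1 u u) * Real.sqrt (ip1 v v)))
    (hcosΨ : Real.cos Ψ = |ip2 u v| / (Real.sqrt (ip2 u u) * Real.sqrt (ip2 v v))) :
    m / M * Real.tan (Φ / 2) ≤ Real.tan (Ψ / 2) ∧
    Real.tan (Ψ / 2) ≤ M / m * Real.tan (Φ / 2) := by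
  have hu : u ≠ 0 := huv.ne_zero 0
  have hv : v ≠ 0 := huv.ne_zero 1
  have hsqrt1 (w : V) (hw : w ≠ 0) : 0 < √(ip1 w w) := Real.sqrt_pos.2 (pos1 w hw)
  have hM0 : 0 < M := hm0.trans_le ((hm.1 ⟨u, hu, rfl⟩).trans (hM.1 ⟨u, hu, rfl⟩))
  have hlow (w : V) : m ^ 2 * ip1 w w ≤ ip2 w w := by
    rcases eq_or_ne w 0 with rfl | hw
    · simp
    have h := (le_div_iff₀ (hsqrt1 w hw)).1 (hm.1 ⟨w, hw, rfl⟩)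
    have hpos := hsqrt1 w hw
    have h2 := pow_le_pow_left₀ (by positivity) h 2
    rwa [mul_pow, Real.sq_sqrt (pos1 w hw).le, Real.sq_sqrt (pos2 w hw).le] at h2
  have hupp (w : V) : ip2 w w ≤ M ^ 2 * ip1 w w := by
    rcases eq_or_ne w 0 with rfl | hw
    · simp
    have h := (div_le_iff₀ (hsqrt1 w hw)).1 (hM.1 ⟨w, hw, rfl⟩)
    have h2 := pow_le_pow_left₀ (Real.sqrt_nonneg _) h 2
    rwa [mul_pow, Real.sq_sqrt (pos1 w hw).le, Real.sq_sqrt (pos2 w hw).le] at h2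
  have hcos {θ : ℝ} (hθ : θ ∈ Set.Icc 0 (Real.pi / 2)) : 0 ≤ Real.cos θ :=
    Real.cos_nonneg_of_mem_Icc ⟨by linarith [hθ.1, Real.pi_pos], hθ.2⟩
  have hlow' (w : V) : (M⁻¹) ^ 2 * ip2 w w ≤ ip1 w w := by
    rw [inv_pow, inv_mul_le_iff₀ (by positivity)]
    exact hupp w
  have hupp' (w : V) : ip1 w w ≤ (m⁻¹) ^ 2 * ip2 w w := by
    rw [inv_pow, le_inv_mul_iff₀ (by positivity)]
    exact hlow w
  constructor
  · have h := mul_tan_half_le_mul_tan_half (inv_pos.2 hm0).le hΨ hΦ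
      (wielandt_cos_le ip2 ip1 symm2 symm1 pos2 pos1 hlow' hupp' hu hv (hcos hΦ)
        (Real.cos_le_one Φ) hcosΨ hcosΦ)
    rwa [le_inv_mul_iff₀ hm0, ← mul_assoc, ← div_eq_mul_inv] at h
  · have h := mul_tan_half_le_mul_tan_half hM0.le hΦ hΨ
      (wielandt_cos_le ip1 ip2 symm1 symm2 pos1 pos2 hlow hupp hu hv (hcos hΨ)
        (Real.cos_le_one Ψ) hcosΦ hcosΨ)
    rwa [div_mul_eq_mul_div, le_div_iff₀' hm0]
end

section
/- Suppose u and v are non-zero vectors in V that are orthogonal with respect to ⟨·,·⟩₁, i.e., ⟨u,v⟩₁ = 0. Then |⟨u,v⟩₂|/(‖u‖₂‖v‖₂) ≤ (M² − m²)/(M² + m²). -/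
/-- If `m² ⟨w,w⟩₁ ≤ ⟨w,w⟩₂ ≤ M² ⟨w,w⟩₁` for all `w`, then `⟨·,·⟩₁`-orthogonal vectors satisfy the
one-sided, division-free Wielandt inequality. -/
theorem wielandt_of_form_bounds {V : Type*} [AddCommGroup V] [Module ℝ V]
    (ip1 ip2 : V →ₗ[ℝ] V →ₗ[ℝ] ℝ)
    (symm1 : ∀ u v : V, ip1 u v = ip1 v u) (symm2 : ∀ u v : V, ip2 u v = ip2 v u)
    {a b : ℝ} (ha : 0 ≤ a) (hb : 0 ≤ b)
    (hlower : ∀ w : V, a * ip1 w w ≤ ip2 w w) (hupper : ∀ w : V, ip2 w w ≤ b * ip1 w w)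
    {u v : V} {r s : ℝ} (hr : 0 < r) (hs : 0 < s) (hru : r ^ 2 = ip2 u u) (hsv : s ^ 2 = ip2 v v)
    (horth : ip1 u v = 0) :
    ip2 u v * (b + a) ≤ (b - a) * (r * s) := by
  have horth' : ip1 v u = 0 := by rw [symm1, horth]
  have hl := mul_le_mul_of_nonneg_left (hlower (s • u - r • v)) hb
  have hu := mul_le_mul_of_nonneg_left (hupper (s • u + r • v)) ha
  simp only [map_add, map_sub, map_smul, LinearMap.add_apply, LinearMap.sub_apply,
    LinearMap.smul_apply, smul_eq_mul, horth, horth', symm2 v u, ← hru, ← hsv] at hl hu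
  refine le_of_mul_le_mul_left ?_ (show 0 < 2 * (r * s) by positivity)
  linarith


/-- Corollary 2.7 (Wielandt inequality in inner product spaces): if `u, v` are
non-zero and orthogonal with respect to the first inner product, then
`|⟨u,v⟩₂|/(‖u‖₂‖v‖₂) ≤ (M² − m²)/(M² + m²)`. -/
theorem wielandt_inner_product
    {V : Type*} [AddCommGroup V] [Module ℝ V]
    (ip1 ip2 : V →ₗ[ℝ] V →ₗ[ℝ] ℝ)
    (symm1 : ∀ u v : V, ip1 u v = ip1 v u)
    (symm2 : ∀ u v : V, ip2 u v = ip2 v u)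
    (pos1 : ∀ v : V, v ≠ 0 → 0 < ip1 v v)
    (pos2 : ∀ v : V, v ≠ 0 → 0 < ip2 v v)
    (m M : ℝ) (hm0 : 0 < m)
    (hm : IsGLB {r : ℝ | ∃ v : V, v ≠ 0 ∧ r = Real.sqrt (ip2 v v) / Real.sqrt (ip1 v v)} m)
    (hM : IsLUB {r : ℝ | ∃ v : V, v ≠ 0 ∧ r = Real.sqrt (ip2 v v) / Real.sqrt (ip1 v v)} M)
    (u v : V) (hu : u ≠ 0) (hv : v ≠ 0) (horth : ip1 u v = 0) :
    |ip2 u v| / (Real.sqrt (ip2 u u) * Real.sqrt (ip2 v v)) ≤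
      (M ^ 2 - m ^ 2) / (M ^ 2 + m ^ 2) := by
  have hsqrt1 : ∀ w : V, w ≠ 0 → 0 < √(ip1 w w) := fun w hw => Real.sqrt_pos.2 (pos1 w hw)
  have hsqrt2 : ∀ w : V, w ≠ 0 → 0 < √(ip2 w w) := fun w hw => Real.sqrt_pos.2 (pos2 w hw)
  have hlower : ∀ w : V, m ^ 2 * ip1 w w ≤ ip2 w w := by
    intro w
    rcases eq_or_ne w 0 with rfl | hw
    · simp
    have h := (le_div_iff₀ (hsqrt1 w hw)).1 (hm.1 ⟨w, hw, rfl⟩)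
    have h2 := pow_le_pow_left₀ (mul_nonneg hm0.le (Real.sqrt_nonneg _)) h 2
    rwa [mul_pow, Real.sq_sqrt (pos1 w hw).le, Real.sq_sqrt (pos2 w hw).le] at h2
  have hupper : ∀ w : V, ip2 w w ≤ M ^ 2 * ip1 w w := by
    intro w
    rcases eq_or_ne w 0 with rfl | hw
    · simp
    have h := (div_le_iff₀ (hsqrt1 w hw)).1 (hM.1 ⟨w, hw, rfl⟩)
    have h2 := pow_le_pow_left₀ (Real.sqrt_nonneg _) h 2
    rwa [mul_pow, Real.sq_sqrt (pos1 w hw).le, Real.sq_sqrt (pos2 w hw).le] at h2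
  have hr := hsqrt2 u hu
  have hs := hsqrt2 v hv
  have hru := Real.sq_sqrt (pos2 u hu).le
  have hsv := Real.sq_sqrt (pos2 v hv).le
  have hpos := wielandt_of_form_bounds ip1 ip2 symm1 symm2 (sq_nonneg m) (sq_nonneg M)
    hlower hupper hr hs hru hsv horth
  have hneg := wielandt_of_form_bounds ip1 ip2 symm1 symm2 (sq_nonneg m) (sq_nonneg M)
    hlower hupper (v := -v) hr hs hru (by simpa using hsv) (by simpa using horth)
  rw [map_neg] at hneg
  have hden : 0 < M ^ 2 + m ^ 2 := by positivity
  rw [div_le_div_iff₀ (mul_pos hr hs) hden]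
  rcases abs_choice (ip2 u v) with h | h <;> rw [h] <;> assumption
end

section
/- For linearly independent vectors u and v in V, −2(M − m)/(M + m) ≤ ⟨u,v⟩₂/(‖u‖₂‖v‖₂) − ⟨u,v⟩₁/(‖u‖₁‖v‖₁) ≤ 2(M − m)/(M + m). -/
/-- If `m² (1 + c) (1 - C) ≤ M² (1 - c) (1 + C)` for cosines `c`, `C`, then
`c - C ≤ 2 (M - m) / (M + m)`. -/
lemma sub_le_of_half_angle_bound {m M c C : ℝ} (hm : 0 < m) (hmM : m ≤ M)
    (hc : c ≤ 1) (hC : -1 ≤ C)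
    (h : m ^ 2 * ((1 + c) * (1 - C)) ≤ M ^ 2 * ((1 - c) * (1 + C))) :
    c - C ≤ 2 * ((M - m) / (M + m)) := by
  have hs : 0 < M + m := by linarith
  rw [← mul_div_assoc, le_div_iff₀ hs]
  by_contra! hlt
  have hneg : (M - m) * (c - C) - 2 * (M + m) < 0 := by
    nlinarith [mul_le_mul_of_nonneg_left (show c - C ≤ 2 by linarith) (sub_nonneg.2 hmM)]
  have hsq : 0 ≤ (M - m) * (M + m) * (c + C) ^ 2 :=
    mul_nonneg (mul_nonneg (sub_nonneg.2 hmM) hs.le) (sq_nonneg _)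
  nlinarith [mul_neg_of_pos_of_neg (sub_pos.2 hlt) hneg]

section BilinearForm

variable {V : Type*} [AddCommGroup V] [Module ℝ V]

lemma apply_smul_add_smul_self (B : V →ₗ[ℝ] V →ₗ[ℝ] ℝ) (symm : ∀ u v : V, B u v = B v u)
    (s t : ℝ) (u v : V) :
    B (s • u + t • v) (s • u + t • v) = s ^ 2 * B u u + 2 * (s * t) * B u v + t ^ 2 * B v v := by
  simp only [map_add, map_smul, LinearMap.add_apply, LinearMap.smul_apply, smul_eq_mul, symm v u]
  ring

lemma abs_apply_le_sqrt_mul_sqrt (B : V →ₗ[ℝ] V →ₗ[ℝ] ℝ) (symm : ∀ u v : V, B u v = B v u)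
    (nonneg : ∀ v : V, 0 ≤ B v v) (u v : V) :
    |B u v| ≤ √(B u u) * √(B v v) := by
  rw [← Real.sqrt_mul (nonneg u)]
  refine Real.abs_le_sqrt ?_
  rw [sq]
  nth_rewrite 2 [symm u v]
  exact LinearMap.BilinForm.apply_mul_apply_le_of_forall_zero_le B nonneg u v

/-- The half-angle comparison behind the generalized Wielandt inequality, which gives an
upper bound for the difference of the two cosines. -/
lemma cos_sub_cos_le (ip1 ip2 : V →ₗ[ℝ] V →ₗ[ℝ] ℝ)
    (symm1 : ∀ u v : V, ip1 u v = ip1 v u) (symm2 : ∀ u v : V, ip2 u v = ip2 v u)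
    (pos1 : ∀ v : V, v ≠ 0 → 0 < ip1 v v) (pos2 : ∀ v : V, v ≠ 0 → 0 < ip2 v v)
    {m M : ℝ} (hm : 0 < m) (hmM : m ≤ M)
    (hlow : ∀ w : V, m ^ 2 * ip1 w w ≤ ip2 w w) (hupp : ∀ w : V, ip2 w w ≤ M ^ 2 * ip1 w w)
    {u v : V} (hu : u ≠ 0) (hv : v ≠ 0) :
    ip1 u v / (√(ip1 u u) * √(ip1 v v)) - ip2 u v / (√(ip2 u u) * √(ip2 v v)) ≤
      2 * ((M - m) / (M + m)) := by
  have nonneg {B : V →ₗ[ℝ] V →ₗ[ℝ] ℝ} (pos : ∀ v : V, v ≠ 0 → 0 < B v v) (w : V) :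
      0 ≤ B w w := by
    obtain rfl | hw := eq_or_ne w 0
    · simp
    · exact (pos w hw).le
  have cs1 := abs_le.1 (abs_apply_le_sqrt_mul_sqrt ip1 symm1 (nonneg pos1) u v)
  have cs2 := abs_le.1 (abs_apply_le_sqrt_mul_sqrt ip2 symm2 (nonneg pos2) u v)
  have hl := hlow (√(ip2 v v) • u + √(ip2 u u) • v)
  have hr := hupp (√(ip1 v v) • u + (-√(ip1 u u)) • v)
  simp only [apply_smul_add_smul_self ip1 symm1, apply_smul_add_smul_self ip2 symm2] at hl hr
  have hp := Real.sqrt_pos.2 (pos1 u hu)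
  have hq := Real.sqrt_pos.2 (pos1 v hv)
  have ha := Real.sqrt_pos.2 (pos2 u hu)
  have hb := Real.sqrt_pos.2 (pos2 v hv)
  have ep := Real.sq_sqrt (pos1 u hu).le
  have eq := Real.sq_sqrt (pos1 v hv).le
  have ea := Real.sq_sqrt (pos2 u hu).le
  have eb := Real.sq_sqrt (pos2 v hv).le
  set p := √(ip1 u u)
  set q := √(ip1 v v)
  set a := √(ip2 u u)
  set b := √(ip2 v v)
  rw [← ep, ← eq, ← ea, ← eb] at hl hr
  have hpq := mul_pos hp hq
  have hab := mul_pos ha hb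
  have hlow' : m ^ 2 * (p * q + ip1 u v) ≤ a * b + ip2 u v := by
    refine le_of_mul_le_mul_left ?_ hab
    nlinarith [mul_nonneg (sq_nonneg m) (sq_nonneg (b * p - a * q))]
  have hupp' : a * b - ip2 u v ≤ M ^ 2 * (p * q - ip1 u v) := by
    refine le_of_mul_le_mul_left ?_ hpq
    nlinarith [sq_nonneg (q * a - p * b)]
  refine sub_le_of_half_angle_bound hm hmM ((div_le_one hpq).2 cs1.2)
    ((le_div_iff₀ hab).2 (by linarith [cs2.1])) ?_
  have hprod : m ^ 2 * ((p * q + ip1 u v) * (a * b - ip2 u v)) ≤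
      M ^ 2 * ((p * q - ip1 u v) * (a * b + ip2 u v)) := by
    have h1 := mul_le_mul_of_nonneg_right hlow' (sub_nonneg.2 cs2.2)
    have h2 := mul_le_mul_of_nonneg_right hupp' (show 0 ≤ a * b + ip2 u v by linarith [cs2.1])
    linarith
  rw [one_add_div hpq.ne', one_sub_div hpq.ne', one_add_div hab.ne', one_sub_div hab.ne',
    div_mul_div_comm, div_mul_div_comm, ← mul_div_assoc, ← mul_div_assoc]
  gcongr

end BilinearForm

/-- Theorem 2.8, inequality (2.10): for independent vectors `u, v`,
`−2(M−m)/(M+m) ≤ ⟨u,v⟩₂/(‖u‖₂‖v‖₂) − ⟨u,v⟩₁/(‖u‖₁‖v‖₁) ≤ 2(M−m)/(M+m)`. -/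
theorem cos_difference_bounds
    {V : Type*} [AddCommGroup V] [Module ℝ V]
    (ip1 ip2 : V →ₗ[ℝ] V →ₗ[ℝ] ℝ)
    (symm1 : ∀ u v : V, ip1 u v = ip1 v u)
    (symm2 : ∀ u v : V, ip2 u v = ip2 v u)
    (pos1 : ∀ v : V, v ≠ 0 → 0 < ip1 v v)
    (pos2 : ∀ v : V, v ≠ 0 → 0 < ip2 v v)
    (m M : ℝ) (hm0 : 0 < m)
    (hm : IsGLB {r : ℝ | ∃ v : V, v ≠ 0 ∧ r = Real.sqrt (ip2 v v) / Real.sqrt (ip1 v v)} m)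
    (hM : IsLUB {r : ℝ | ∃ v : V, v ≠ 0 ∧ r = Real.sqrt (ip2 v v) / Real.sqrt (ip1 v v)} M)
    (u v : V) (huv : LinearIndependent ℝ ![u, v]) :
    -(2 * ((M - m) / (M + m))) ≤
        ip2 u v / (Real.sqrt (ip2 u u) * Real.sqrt (ip2 v v)) -
          ip1 u v / (Real.sqrt (ip1 u u) * Real.sqrt (ip1 v v)) ∧
      ip2 u v / (Real.sqrt (ip2 u u) * Real.sqrt (ip2 v v)) -
          ip1 u v / (Real.sqrt (ip1 u u) * Real.sqrt (ip1 v v)) ≤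
        2 * ((M - m) / (M + m)) := by
  have hu : u ≠ 0 := huv.ne_zero 0
  have hv : v ≠ 0 := huv.ne_zero 1
  have hmM : m ≤ M := (hm.1 ⟨u, hu, rfl⟩).trans (hM.1 ⟨u, hu, rfl⟩)
  have hlow (w : V) : m ^ 2 * ip1 w w ≤ ip2 w w := by
    obtain rfl | hw := eq_or_ne w 0
    · simp
    have h := (le_div_iff₀ (Real.sqrt_pos.2 (pos1 w hw))).1 (hm.1 ⟨w, hw, rfl⟩)
    have h2 := pow_le_pow_left₀ (by positivity) h 2
    rwa [mul_pow, Real.sq_sqrt (pos1 w hw).le, Real.sq_sqrt (pos2 w hw).le] at h2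
  have hupp (w : V) : ip2 w w ≤ M ^ 2 * ip1 w w := by
    obtain rfl | hw := eq_or_ne w 0
    · simp
    have h := (div_le_iff₀ (Real.sqrt_pos.2 (pos1 w hw))).1 (hM.1 ⟨w, hw, rfl⟩)
    have h2 := pow_le_pow_left₀ (by positivity) h 2
    rwa [mul_pow, Real.sq_sqrt (pos1 w hw).le, Real.sq_sqrt (pos2 w hw).le] at h2
  have h := cos_sub_cos_le ip1 ip2 symm1 symm2 pos1 pos2 hm0 hmM hlow hupp hu hv
  have h' := cos_sub_cos_le ip1 ip2 symm1 symm2 pos1 pos2 hm0 hmM hlow hupp hu (neg_ne_zero.2 hv)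
  simp only [map_neg, LinearMap.neg_apply, neg_neg, neg_div] at h'
  constructor <;> linarith
end

section
/- For linearly independent vectors u and v in V, if ⟨u,v⟩₁ ≥ 0, then ⟨u,v⟩₂/(‖u‖₂‖v‖₂) − ⟨u,v⟩₁/(‖u‖₁‖v‖₁) ≤ (M² − m²)/(M² + m²). -/
/-- The scalar inequality behind the angle comparison: `s` and `c` are the cosines of the two angles,
`T ± 2 * D * c` and `2 * E * (1 ± s)` the squared norms of the sum and difference of the vectors. -/
theorem cos_sub_cos_le_of_norm_sq_bounds {a b s c T D E : ℝ} (ha : 0 < a) (hab : a ≤ b)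
    (hc : 0 ≤ c) (hD : 0 < D) (hT : 2 * D ≤ T) (hs₁ : 0 ≤ 1 - s) (hs₂ : 0 ≤ 1 + s)
    (hsub : a * (T - 2 * D * c) ≤ 2 * E * (1 - s))
    (hadd : 2 * E * (1 + s) ≤ b * (T + 2 * D * c)) :
    s - c ≤ (b - a) / (b + a) := by
  rw [le_div_iff₀ (by linarith)]
  have key : 0 ≤ T * (b * (1 - s) - a * (1 + s)) + 2 * D * c * (b * (1 - s) + a * (1 + s)) := by
    have h₁ := mul_le_mul_of_nonneg_left hsub hs₂
    have h₂ := mul_le_mul_of_nonneg_left hadd hs₁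
    linarith
  have hcab : 0 ≤ c * (b + a) := mul_nonneg hc (by linarith)
  rcases le_total 0 (b * (1 - s) - a * (1 + s)) with h | h
  · linarith
  · have h₁ : 0 ≤ 2 * D * ((b * (1 - s) - a * (1 + s)) + c * (b * (1 - s) + a * (1 + s))) := by
      have := mul_le_mul_of_nonpos_right hT h
      linarith
    have h₂ := nonneg_of_mul_nonneg_right h₁ (by linarith : (0 : ℝ) < 2 * D)
    have hs : 0 ≤ s := by
      by_contra! hneg
      nlinarith
    have h₃ : 0 ≤ s * (c * (b - a)) := mul_nonneg hs (mul_nonneg hc (by linarith))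
    linarith


/-- Theorem 2.8, inequality (2.11): for independent vectors `u, v` with
`⟨u,v⟩₁ ≥ 0`, `⟨u,v⟩₂/(‖u‖₂‖v‖₂) − ⟨u,v⟩₁/(‖u‖₁‖v‖₁) ≤ (M²−m²)/(M²+m²)`. -/
theorem cos_difference_bound_nonneg
    {V : Type*} [AddCommGroup V] [Module ℝ V]
    (ip1 ip2 : V →ₗ[ℝ] V →ₗ[ℝ] ℝ)
    (symm1 : ∀ u v : V, ip1 u v = ip1 v u)
    (symm2 : ∀ u v : V, ip2 u v = ip2 v u)
    (pos1 : ∀ v : V, v ≠ 0 → 0 < ip1 v v)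
    (pos2 : ∀ v : V, v ≠ 0 → 0 < ip2 v v)
    (m M : ℝ) (hm0 : 0 < m)
    (hm : IsGLB {r : ℝ | ∃ v : V, v ≠ 0 ∧ r = Real.sqrt (ip2 v v) / Real.sqrt (ip1 v v)} m)
    (hM : IsLUB {r : ℝ | ∃ v : V, v ≠ 0 ∧ r = Real.sqrt (ip2 v v) / Real.sqrt (ip1 v v)} M)
    (u v : V) (huv : LinearIndependent ℝ ![u, v]) (hpos : 0 ≤ ip1 u v) :
    ip2 u v / (Real.sqrt (ip2 u u) * Real.sqrt (ip2 v v)) -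
        ip1 u v / (Real.sqrt (ip1 u u) * Real.sqrt (ip1 v v)) ≤
      (M ^ 2 - m ^ 2) / (M ^ 2 + m ^ 2) := by
  have hu : u ≠ 0 := huv.ne_zero 0
  have hv : v ≠ 0 := huv.ne_zero 1
  have nonneg1 (x : V) : 0 ≤ ip1 x x := by
    rcases eq_or_ne x 0 with rfl | hx
    · simp
    · exact (pos1 x hx).le
  have nonneg2 (x : V) : 0 ≤ ip2 x x := by
    rcases eq_or_ne x 0 with rfl | hx
    · simp
    · exact (pos2 x hx).le
  have hmM : m ≤ M := (hm.1 ⟨u, hu, rfl⟩).trans (hM.1 ⟨u, hu, rfl⟩)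
  have lower (x : V) : m ^ 2 * ip1 x x ≤ ip2 x x := by
    rcases eq_or_ne x 0 with rfl | hx
    · simp
    · have h := hm.1 ⟨x, hx, rfl⟩
      rw [le_div_iff₀ (Real.sqrt_pos.2 (pos1 x hx))] at h
      have h' := pow_le_pow_left₀ (by positivity) h 2
      rwa [mul_pow, Real.sq_sqrt (nonneg1 x), Real.sq_sqrt (nonneg2 x)] at h'
  have upper (x : V) : ip2 x x ≤ M ^ 2 * ip1 x x := by
    rcases eq_or_ne x 0 with rfl | hx
    · simp
    · have h := hM.1 ⟨x, hx, rfl⟩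
      rw [div_le_iff₀ (Real.sqrt_pos.2 (pos1 x hx))] at h
      have h' := pow_le_pow_left₀ (by positivity) h 2
      rwa [mul_pow, Real.sq_sqrt (nonneg1 x), Real.sq_sqrt (nonneg2 x)] at h'
  have hP := Real.sqrt_pos.2 (pos1 u hu)
  have hR := Real.sqrt_pos.2 (pos1 v hv)
  have hA := Real.sqrt_pos.2 (pos2 u hu)
  have hB := Real.sqrt_pos.2 (pos2 v hv)
  have hP2 := Real.sq_sqrt (nonneg1 u)
  have hR2 := Real.sq_sqrt (nonneg1 v)
  have hA2 := Real.sq_sqrt (nonneg2 u)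
  have hB2 := Real.sq_sqrt (nonneg2 v)
  set P := Real.sqrt (ip1 u u)
  set R := Real.sqrt (ip1 v v)
  set A := Real.sqrt (ip2 u u)
  set B := Real.sqrt (ip2 v v)
  set s := ip2 u v / (A * B) with hs
  set c := ip1 u v / (P * R) with hc
  have hs' : ip2 u v = s * (A * B) := by rw [hs]; field_simp
  have hc' : ip1 u v = c * (P * R) := by rw [hc]; field_simp
  have sub1 : ip1 (B • u - A • v) (B • u - A • v) =
      (B ^ 2 * P ^ 2 + A ^ 2 * R ^ 2) - 2 * (A * B * P * R) * c := by
    simp only [map_sub, map_smul, LinearMap.sub_apply, LinearMap.smul_apply, smul_eq_mul,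
      symm1 v u, hc', ← hP2, ← hR2]
    ring
  have add1 : ip1 (B • u + A • v) (B • u + A • v) =
      (B ^ 2 * P ^ 2 + A ^ 2 * R ^ 2) + 2 * (A * B * P * R) * c := by
    simp only [map_add, map_smul, LinearMap.add_apply, LinearMap.smul_apply, smul_eq_mul,
      symm1 v u, hc', ← hP2, ← hR2]
    ring
  have sub2 : ip2 (B • u - A • v) (B • u - A • v) = 2 * (A ^ 2 * B ^ 2) * (1 - s) := by
    simp only [map_sub, map_smul, LinearMap.sub_apply, LinearMap.smul_apply, smul_eq_mul,
      symm2 v u, hs', ← hA2, ← hB2]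
    ring
  have add2 : ip2 (B • u + A • v) (B • u + A • v) = 2 * (A ^ 2 * B ^ 2) * (1 + s) := by
    simp only [map_add, map_smul, LinearMap.add_apply, LinearMap.smul_apply, smul_eq_mul,
      symm2 v u, hs', ← hA2, ← hB2]
    ring
  have hE : 0 < 2 * (A ^ 2 * B ^ 2) := by positivity
  refine cos_sub_cos_le_of_norm_sq_bounds (T := B ^ 2 * P ^ 2 + A ^ 2 * R ^ 2)
    (D := A * B * P * R) (E := A ^ 2 * B ^ 2) (by positivity)
    (pow_le_pow_left₀ hm0.le hmM 2) (by positivity) (by positivity) ?_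
    (nonneg_of_mul_nonneg_right (sub2 ▸ nonneg2 _) hE)
    (nonneg_of_mul_nonneg_right (add2 ▸ nonneg2 _) hE)
    (sub1 ▸ sub2 ▸ lower _) (add1 ▸ add2 ▸ upper _)
  linarith [sq_nonneg (B * P - A * R)]
end

section
/- For linearly independent vectors u and v in V, (⟨u,v⟩₁/(‖u‖₁‖v‖₁)) · (⟨u,v⟩₂/(‖u‖₂‖v‖₂)) ≥ −((M − m)/(M + m))². -/
/-- If `A t ^ 2 - 2 B t + C` is nonnegative at `a ≤ b`, and the product of its roots lies between
`a ^ 2` and `b ^ 2`, then its discriminant is controlled by the ratio of `a` and `b`. -/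
lemma four_mul_sq_mul_le_of_quadratic_nonneg {A B C a b : ℝ} (ha : 0 < a) (hab : a ≤ b)
    (hA : 0 ≤ A) (hB : 0 ≤ B) (hCa : a ^ 2 * A ≤ C) (hCb : C ≤ b ^ 2 * A)
    (hfa : 2 * B * a ≤ A * a ^ 2 + C) (hfb : 2 * B * b ≤ A * b ^ 2 + C) :
    4 * B ^ 2 * (a * b) ≤ (a + b) ^ 2 * (A * C) := by
  have hb : 0 < b := ha.trans_le hab
  rcases le_total C (a * b * A) with h | h
  · have hsq : (2 * B * a) ^ 2 ≤ (A * a ^ 2 + C) ^ 2 := by gcongr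
    have hroot : 0 ≤ b * C - a ^ 3 * A := by
      have := mul_le_mul hab hCa (by positivity) hb.le
      linarith
    have hprod := mul_nonneg (sub_nonneg.2 h) hroot
    have := mul_le_mul_of_nonneg_right hsq hb.le
    refine le_of_mul_le_mul_left ?_ ha
    linarith
  · have hsq : (2 * B * b) ^ 2 ≤ (A * b ^ 2 + C) ^ 2 := by gcongr
    have hroot : 0 ≤ b ^ 3 * A - a * C := by
      have := mul_le_mul hab hCb ((by positivity : 0 ≤ a ^ 2 * A).trans hCa) hb.le
      linarith
    have hprod := mul_nonneg (sub_nonneg.2 h) hroot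
    have := mul_le_mul_of_nonneg_right hsq ha.le
    refine le_of_mul_le_mul_left ?_ hb
    linarith

/-- Gram-matrix form of the bound: `p, q` and `P, Q` are the lengths of two vectors, and `c, d` the
cosines of their angles, in two inner products whose norms have ratio between `m` and `M`. -/
lemma neg_sq_le_mul_of_gram_bounds {p q P Q c d m M : ℝ} (hm : 0 < m) (hmM : m ≤ M)
    (hp : 0 < p) (hq : 0 < q) (hP : 0 < P) (hQ : 0 < Q) (hc : c ^ 2 ≤ 1) (hd : d ^ 2 ≤ 1)
    (hmP : m * p ≤ P) (hmQ : m * q ≤ Q) (hMP : P ≤ M * p) (hMQ : Q ≤ M * q)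
    (hlow : (d * (P * Q) - m ^ 2 * (c * (p * q))) ^ 2 ≤
      (P ^ 2 - m ^ 2 * p ^ 2) * (Q ^ 2 - m ^ 2 * q ^ 2))
    (hupp : (M ^ 2 * (c * (p * q)) - d * (P * Q)) ^ 2 ≤
      (M ^ 2 * p ^ 2 - P ^ 2) * (M ^ 2 * q ^ 2 - Q ^ 2)) :
    -(((M - m) / (M + m)) ^ 2) ≤ c * d := by
  have hM : 0 < M := hm.trans_le hmM
  rcases le_or_gt 0 (c * d) with hcd | hcd
  · exact (neg_nonpos.2 (sq_nonneg _)).trans hcd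
  have hcd1 : -1 ≤ c * d := by nlinarith [sq_nonneg (c + d)]
  have hs : 0 < P * Q := mul_pos hP hQ
  have hσ : 0 < p * q := mul_pos hp hq
  have hms : m ^ 2 * (p * q) ≤ P * Q := by
    have := mul_le_mul hmP hmQ (by positivity) hP.le
    linarith
  have hMs : P * Q ≤ M ^ 2 * (p * q) := by
    have := mul_le_mul hMP hMQ hQ.le (by positivity)
    linarith
  have hx : 0 < 1 - c * d := by linarith
  have hA : 0 ≤ (p * q) ^ 2 * (1 - c ^ 2) := mul_nonneg (sq_nonneg _) (by linarith)
  have hB : 0 ≤ P * Q * (p * q) * (1 - c * d) := by positivity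
  have hcross := sq_nonneg (P * q - p * Q)
  have hfa : 2 * (P * Q * (p * q) * (1 - c * d)) * m ^ 2 ≤
      (p * q) ^ 2 * (1 - c ^ 2) * (m ^ 2) ^ 2 + (P * Q) ^ 2 * (1 - d ^ 2) := by
    have := mul_nonneg (sq_nonneg m) hcross
    linarith
  have hfb : 2 * (P * Q * (p * q) * (1 - c * d)) * M ^ 2 ≤
      (p * q) ^ 2 * (1 - c ^ 2) * (M ^ 2) ^ 2 + (P * Q) ^ 2 * (1 - d ^ 2) := by
    have := mul_nonneg (sq_nonneg M) hcross
    linarith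
  have hCa : (m ^ 2) ^ 2 * ((p * q) ^ 2 * (1 - c ^ 2)) ≤ (P * Q) ^ 2 * (1 - d ^ 2) := by
    have : m ^ 2 * (p * q) * (1 - c ^ 2) ≤ P * Q * (1 - c * d) :=
      mul_le_mul hms (by linarith [sq_nonneg c]) (by linarith) hs.le
    have := mul_le_mul_of_nonneg_left this (by positivity : 0 ≤ m ^ 2 * (p * q))
    linarith
  have hCb : (P * Q) ^ 2 * (1 - d ^ 2) ≤ (M ^ 2) ^ 2 * ((p * q) ^ 2 * (1 - c ^ 2)) := by
    have : P * Q * (1 - d ^ 2) ≤ M ^ 2 * (p * q) * (1 - c * d) :=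
      mul_le_mul hMs (by linarith [sq_nonneg d]) (by linarith) (by positivity)
    have := mul_le_mul_of_nonneg_left this hs.le
    linarith
  have hdisc := four_mul_sq_mul_le_of_quadratic_nonneg (by positivity) (by gcongr) hA hB
    hCa hCb hfa hfb
  have hAC : (1 - c ^ 2) * (1 - d ^ 2) ≤ (1 + c * d) ^ 2 := by linarith [sq_nonneg (c + d)]
  have hsq : (2 * (m * M) * (1 - c * d)) ^ 2 ≤ ((m ^ 2 + M ^ 2) * (1 + c * d)) ^ 2 := by
    refine le_of_mul_le_mul_left ?_ (by positivity : 0 < (P * Q * (p * q)) ^ 2)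
    have := mul_le_mul_of_nonneg_left hAC
      (by positivity : 0 ≤ (m ^ 2 + M ^ 2) ^ 2 * (P * Q * (p * q)) ^ 2)
    linarith
  have hlin := (pow_le_pow_iff_left₀ (by positivity)
    (mul_nonneg (by positivity) (by linarith)) two_ne_zero).1 hsq
  rw [neg_le, div_pow, le_div_iff₀ (by positivity)]
  linarith

/-- Cauchy–Schwarz for the difference of two symmetric bilinear forms, one dominating the other. -/
lemma sq_sub_le_of_forall_le {V : Type*} [AddCommGroup V] [Module ℝ V]
    {f g : V →ₗ[ℝ] V →ₗ[ℝ] ℝ} (hf : ∀ u v, f u v = f v u) (hg : ∀ u v, g u v = g v u)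
    (hfg : ∀ v, f v v ≤ g v v) (u v : V) :
    (g u v - f u v) ^ 2 ≤ (g u u - f u u) * (g v v - f v v) := by
  have h := LinearMap.BilinForm.apply_mul_apply_le_of_forall_zero_le (g - f)
    (fun w => by simpa using hfg w) u v
  simpa [sq, hf v u, hg v u] using h

/-- Corollary 2.9: for independent vectors `u, v`,
`(⟨u,v⟩₁/(‖u‖₁‖v‖₁))·(⟨u,v⟩₂/(‖u‖₂‖v‖₂)) ≥ −((M−m)/(M+m))²`. -/
theorem cos_product_lower_bound
    {V : Type*} [AddCommGroup V] [Module ℝ V]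
    (ip1 ip2 : V →ₗ[ℝ] V →ₗ[ℝ] ℝ)
    (symm1 : ∀ u v : V, ip1 u v = ip1 v u)
    (symm2 : ∀ u v : V, ip2 u v = ip2 v u)
    (pos1 : ∀ v : V, v ≠ 0 → 0 < ip1 v v)
    (pos2 : ∀ v : V, v ≠ 0 → 0 < ip2 v v)
    (m M : ℝ) (hm0 : 0 < m)
    (hm : IsGLB {r : ℝ | ∃ v : V, v ≠ 0 ∧ r = Real.sqrt (ip2 v v) / Real.sqrt (ip1 v v)} m)
    (hM : IsLUB {r : ℝ | ∃ v : V, v ≠ 0 ∧ r = Real.sqrt (ip2 v v) / Real.sqrt (ip1 v v)} M)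
    (u v : V) (huv : LinearIndependent ℝ ![u, v]) :
    ip1 u v / (Real.sqrt (ip1 u u) * Real.sqrt (ip1 v v)) *
        (ip2 u v / (Real.sqrt (ip2 u u) * Real.sqrt (ip2 v v))) ≥
      -(((M - m) / (M + m)) ^ 2) := by
  have hu : u ≠ 0 := huv.ne_zero 0
  have hv : v ≠ 0 := huv.ne_zero 1
  have hratio_low (w : V) (hw : w ≠ 0) : m * √(ip1 w w) ≤ √(ip2 w w) :=
    (le_div_iff₀ (Real.sqrt_pos.2 (pos1 w hw))).1 (hm.1 ⟨w, hw, rfl⟩)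
  have hratio_upp (w : V) (hw : w ≠ 0) : √(ip2 w w) ≤ M * √(ip1 w w) :=
    (div_le_iff₀ (Real.sqrt_pos.2 (pos1 w hw))).1 (hM.1 ⟨w, hw, rfl⟩)
  have hmM : m ≤ M := (hm.1 ⟨u, hu, rfl⟩).trans (hM.1 ⟨u, hu, rfl⟩)
  have hM0 : 0 < M := hm0.trans_le hmM
  have nonneg1 (w : V) : 0 ≤ ip1 w w := by
    rcases eq_or_ne w 0 with rfl | hw
    · simp
    · exact (pos1 w hw).le
  have nonneg2 (w : V) : 0 ≤ ip2 w w := by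
    rcases eq_or_ne w 0 with rfl | hw
    · simp
    · exact (pos2 w hw).le
  have hform_low (w : V) : (m ^ 2 • ip1) w w ≤ ip2 w w := by
    rcases eq_or_ne w 0 with rfl | hw
    · simp
    · have := pow_le_pow_left₀ (by positivity) (hratio_low w hw) 2
      rwa [mul_pow, Real.sq_sqrt (nonneg1 w), Real.sq_sqrt (nonneg2 w)] at this
  have hform_upp (w : V) : ip2 w w ≤ (M ^ 2 • ip1) w w := by
    rcases eq_or_ne w 0 with rfl | hw
    · simp
    · have := pow_le_pow_left₀ (by positivity) (hratio_upp w hw) 2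
      rwa [mul_pow, Real.sq_sqrt (nonneg1 w), Real.sq_sqrt (nonneg2 w)] at this
  have hlow := sq_sub_le_of_forall_le (fun x y => by simp [symm1 x y]) symm2 hform_low u v
  have hupp := sq_sub_le_of_forall_le symm2 (fun x y => by simp [symm1 x y]) hform_upp u v
  have hcs1 := sq_sub_le_of_forall_le (f := 0) (by simp) symm1 (by simpa using nonneg1) u v
  have hcs2 := sq_sub_le_of_forall_le (f := 0) (by simp) symm2 (by simpa using nonneg2) u v
  simp only [LinearMap.smul_apply, smul_eq_mul] at hlow hupp
  simp only [LinearMap.zero_apply, sub_zero] at hcs1 hcs2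
  have hp := Real.sqrt_pos.2 (pos1 u hu)
  have hq := Real.sqrt_pos.2 (pos1 v hv)
  have hP := Real.sqrt_pos.2 (pos2 u hu)
  have hQ := Real.sqrt_pos.2 (pos2 v hv)
  have hcos_sq {x y z : ℝ} (hx : 0 < x) (hy : 0 < y) (h : z ^ 2 ≤ x * y) :
      (z / (√x * √y)) ^ 2 ≤ 1 := by
    rw [div_pow, mul_pow, Real.sq_sqrt hx.le, Real.sq_sqrt hy.le]
    exact (div_le_one (mul_pos hx hy)).2 h
  refine neg_sq_le_mul_of_gram_bounds hm0 hmM hp hq hP hQ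
    (hcos_sq (pos1 u hu) (pos1 v hv) hcs1) (hcos_sq (pos2 u hu) (pos2 v hv) hcs2)
    (hratio_low u hu) (hratio_low v hv) (hratio_upp u hu) (hratio_upp v hv) ?_ ?_ <;>
  rwa [div_mul_cancel₀ _ (mul_pos hp hq).ne', div_mul_cancel₀ _ (mul_pos hP hQ).ne',
    Real.sq_sqrt (nonneg1 u), Real.sq_sqrt (nonneg1 v), Real.sq_sqrt (nonneg2 u),
    Real.sq_sqrt (nonneg2 v)]
end
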